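/- arXiv:1211.5217 — 3 statements merged into one kernel-verified Lean document; each statement's English description precedes it below -/
import Mathlib

section
/- Assume a > 2b > 0. Then there exists an increasing sequence {x_k}_{k≥0} contained in (0,1) such that, for every k ≥ 0, the solution (f_{x_k}, g_{x_k}) of the Cauchy problem f' + (2/r)f = g(f² − a g² + b), g' = f(1 − g²), f(0) = 0, g(0) = x_k is defined on all of [0,∞); both f_{x_k} and g_{x_k} have exactly k zeros on (0,∞); and (f_{x_k}, g_{x_k})(r) converges exponentially to (0,0) as r → +∞, i.e. there exist constants C > 0 and K > 0 with |f_{x_k}(r)| + |g_{x_k}(r)| ≤ C exp(−K r) for all r ≥ 0. -/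
open Real Set Filter Topology

noncomputable section

/-- The Hamiltonian energy `H(f,g) = ½ f²(1−g²) + (a/4) g⁴ − (b/2) g²`. -/
def Ham (a b f g : ℝ) : ℝ := 1 / 2 * f ^ 2 * (1 - g ^ 2) + a / 4 * g ^ 4 - b / 2 * g ^ 2

/-- The set `𝒜` of admissible points. -/
def Aadm (a b : ℝ) : Set (ℝ × ℝ) :=
  {p | 2 * p.1 ^ 2 - a * p.2 ^ 2 - (a - 2 * b) ≤ 0 ∧ p.2 ^ 2 ≤ 1}

/-- `φ` is an admissible cutoff function `φ_η`. -/
def IsCutoff (a b η : ℝ) (φ : ℝ → ℝ → ℝ) : Prop :=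
  (∀ f g, φ f g ∈ Icc (0 : ℝ) 1) ∧
  ContDiffOn ℝ (⊤ : ℕ∞) (fun p : ℝ × ℝ => φ p.1 p.2)
    (Ioo (-Real.sqrt (a - b)) (Real.sqrt (a - b)) ×ˢ (univ : Set ℝ)) ∧
  (∀ f g, φ f g = φ |f| |g|) ∧
  (∀ f g, Real.sqrt (a - b) - η / 2 ≤ |f| → φ f g = 0) ∧
  (∀ f g, |f| ≤ Real.sqrt (a - b) - η → φ f g = 1)

/-- `(f, g)` is a `C¹` solution on `s` of the original Cauchy problem
`f' + (2/r) f = g(f² − a g² + b)`, `g' = f(1 − g²)`, `f(0) = 0`, `g(0) = x`. -/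
def IsSolOn (a b x : ℝ) (f g : ℝ → ℝ) (s : Set ℝ) : Prop :=
  f 0 = 0 ∧ g 0 = x ∧ ContinuousOn f s ∧ ContinuousOn g s ∧
  ∀ r ∈ s, 0 < r →
    HasDerivAt f (g r * ((f r) ^ 2 - a * (g r) ^ 2 + b) - 2 / r * f r) r ∧
    HasDerivAt g (f r * (1 - (g r) ^ 2)) r

/-- `(f, g)` is a `C¹` solution on `s` of the regularized Cauchy problem
`f' + (2 φ(f,g)/r) f = g(f² − a g² + b)`, `g' = f(1 − g²)`, `f(0) = 0`, `g(0) = x`. -/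
def IsRegSolOn (a b : ℝ) (φ : ℝ → ℝ → ℝ) (x : ℝ) (f g : ℝ → ℝ) (s : Set ℝ) : Prop :=
  f 0 = 0 ∧ g 0 = x ∧ ContinuousOn f s ∧ ContinuousOn g s ∧
  ∀ r ∈ s, 0 < r →
    HasDerivAt f (g r * ((f r) ^ 2 - a * (g r) ^ 2 + b) - 2 * φ (f r) (g r) / r * f r) r ∧
    HasDerivAt g (f r * (1 - (g r) ^ 2)) r

/-- `(f, g)` is a solution on `s` of the autonomous (Hamiltonian) system
`f' = g(f² − a g² + b)`, `g' = f(1 − g²)` with initial data `(fi, gi)`. -/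
def IsAutSolOn (a b fi gi : ℝ) (f g : ℝ → ℝ) (s : Set ℝ) : Prop :=
  f 0 = fi ∧ g 0 = gi ∧ ContinuousOn f s ∧ ContinuousOn g s ∧
  ∀ r ∈ s,
    HasDerivAt f (g r * ((f r) ^ 2 - a * (g r) ^ 2 + b)) r ∧
    HasDerivAt g (f r * (1 - (g r) ^ 2)) r

/-- `(f, g)` is a solution on `s` of the shifted regularized system
`f' + (2 φ(f,g)/(ρ+r)) f = g(f² − a g² + b)`, `g' = f(1 − g²)` with initial data `(fi, gi)`. -/
def IsShiftSolOn (a b : ℝ) (φ : ℝ → ℝ → ℝ) (ρ fi gi : ℝ) (f g : ℝ → ℝ) (s : Set ℝ) : Prop :=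
  f 0 = fi ∧ g 0 = gi ∧ ContinuousOn f s ∧ ContinuousOn g s ∧
  ∀ r ∈ s,
    HasDerivAt f (g r * ((f r) ^ 2 - a * (g r) ^ 2 + b) - 2 * φ (f r) (g r) / (ρ + r) * f r) r ∧
    HasDerivAt g (f r * (1 - (g r) ^ 2)) r

/-- The interval `[0, R)` with possibly infinite right endpoint. -/
def edom (R : EReal) : Set ℝ := {r : ℝ | 0 ≤ r ∧ (r : EReal) < R}

/-- `g` changes sign at `r₀` relative to the interval `s`. -/
def ChangesSignAt (g : ℝ → ℝ) (s : Set ℝ) (r₀ : ℝ) : Prop :=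
  g r₀ = 0 ∧ ∃ ε > 0, Icc (r₀ - ε) (r₀ + ε) ⊆ s ∧
    g (r₀ - ε) * g (r₀ + ε) < 0 ∧ ∀ r ∈ Ioo (0 : ℝ) ε, g (r₀ - r) * g (r₀ + r) ≤ 0

/-- `g` changes sign exactly `k` times on `s`. -/
def ChangesSignExactly (g : ℝ → ℝ) (s : Set ℝ) (k : ℕ) : Prop :=
  {r | ChangesSignAt g s r}.Finite ∧ {r | ChangesSignAt g s r}.ncard = k

/-- The set `A_k`, for the family of solutions `x ↦ (F x, G x)`. -/
def Aset (a b : ℝ) (F G : ℝ → ℝ → ℝ) (k : ℕ) : Set ℝ :=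
  {x | x ∈ Ioo (0 : ℝ) 1 ∧
    (∃ L, L < 0 ∧ Tendsto (fun r => Ham a b (F x r) (G x r)) atTop (nhds L)) ∧
    ChangesSignExactly (G x) (Ioi 0) k}

/-- The set `I_k`, for the family of solutions `x ↦ (F x, G x)`. -/
def Iset (a b : ℝ) (F G : ℝ → ℝ → ℝ) (k : ℕ) : Set ℝ :=
  {x | x ∈ Ioo (0 : ℝ) 1 ∧
    Tendsto (fun r => (F x r, G x r)) atTop (nhds ((0 : ℝ), (0 : ℝ))) ∧
    ChangesSignExactly (G x) (Ioi 0) k}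

open scoped BoundedContinuousFunction


/-- The averaged primitive `r⁻ᵖ ∫₀ʳ sᵖ N(s) ds`, extended by zero to negative `r`. -/
def avgInt (p : ℕ) (N : ℝ → ℝ) (r : ℝ) : ℝ :=
  max r 0 * ∫ t in (0 : ℝ)..1, t ^ p * N (max r 0 * t)

lemma continuous_avgInt {N : ℝ → ℝ} (hN : Continuous N) (p : ℕ) : Continuous (avgInt p N) := by
  unfold avgInt
  refine (by fun_prop : Continuous fun r : ℝ => max r 0).mul ?_
  apply intervalIntegral.continuous_parametric_intervalIntegral_of_continuous'
  fun_prop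

lemma abs_avgInt_sub_le {N N' : ℝ → ℝ} (hN : Continuous N) (hN' : Continuous N') (p : ℕ)
    {lam C : ℝ} (hlam : 0 < lam) (hC : 0 ≤ C)
    (h : ∀ s, 0 ≤ s → |N s - N' s| ≤ C * exp (lam * s)) (r : ℝ) :
    |avgInt p N r - avgInt p N' r| ≤ C / lam * exp (lam * max r 0) := by
  unfold avgInt
  set R := max r 0 with hR
  have hR0 : 0 ≤ R := le_max_right _ _
  have hi : ∀ F : ℝ → ℝ, Continuous F →
      IntervalIntegrable (fun t => t ^ p * F (R * t)) MeasureTheory.volume 0 1 := fun F hF =>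
    (by fun_prop : Continuous fun t => t ^ p * F (R * t)).intervalIntegrable _ _
  rw [← mul_sub, ← intervalIntegral.integral_sub (hi N hN) (hi N' hN'), abs_mul,
    abs_of_nonneg hR0]
  have h1 : |∫ t in (0 : ℝ)..1, (t ^ p * N (R * t) - t ^ p * N' (R * t))|
      ≤ ∫ t in (0 : ℝ)..1, C * exp (lam * (R * t)) := by
    refine (intervalIntegral.abs_integral_le_integral_abs zero_le_one).trans ?_
    refine intervalIntegral.integral_mono_on zero_le_one ?_ ?_ ?_
    · exact (by fun_prop :
        Continuous fun t => |t ^ p * N (R * t) - t ^ p * N' (R * t)|).intervalIntegrable _ _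
    · exact (by fun_prop :
        Continuous fun t => C * exp (lam * (R * t))).intervalIntegrable _ _
    · intro t ht
      rw [← mul_sub, abs_mul, abs_of_nonneg (pow_nonneg ht.1 p)]
      calc t ^ p * |N (R * t) - N' (R * t)| ≤ 1 * |N (R * t) - N' (R * t)| := by
            gcongr
            exact pow_le_one₀ ht.1 ht.2
        _ ≤ _ := by rw [one_mul]; exact h _ (mul_nonneg hR0 ht.1)
  refine (mul_le_mul_of_nonneg_left h1 hR0).trans ?_
  have h2 := intervalIntegral.mul_integral_comp_mul_left (a := 0) (b := 1)
    (f := fun s => C * exp (lam * s)) R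
  rw [h2, intervalIntegral.integral_const_mul]
  have h4 : ∫ s in (R * 0)..(R * 1), exp (lam * s) = (exp (lam * R) - 1) / lam := by
    rw [intervalIntegral.integral_comp_mul_left (fun s => exp s) hlam.ne']
    simp [div_eq_inv_mul]
  rw [h4]
  rw [div_mul_eq_mul_div, mul_div_assoc']
  gcongr
  linarith

lemma avgInt_eq {N : ℝ → ℝ} (p : ℕ) {r : ℝ} (hr : 0 ≤ r) :
    r ^ p * avgInt p N r = ∫ s in (0 : ℝ)..r, s ^ p * N s := by
  unfold avgInt
  rw [max_eq_left hr]
  have h2 := intervalIntegral.mul_integral_comp_mul_left (a := 0) (b := 1)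
    (f := fun s => s ^ p * N s) r
  simp only [mul_zero, mul_one] at h2
  rw [← h2, mul_left_comm, ← intervalIntegral.integral_const_mul]
  simp only [mul_pow, mul_assoc]

/-- Global solvability of the singular integral system
`f = r⁻² ∫₀ʳ s² N₁(f, g) ds`, `g = x + ∫₀ʳ N₂(f, g) ds`,
together with Lipschitz dependence on the initial value. -/
theorem exists_integral_solution {N₁ N₂ : ℝ × ℝ → ℝ} {L B : ℝ} (hL : 0 < L)
    (h₁ : ∀ p q, |N₁ p - N₁ q| ≤ L * ‖p - q‖) (h₂ : ∀ p q, |N₂ p - N₂ q| ≤ L * ‖p - q‖)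
    (hB₁ : ∀ p, |N₁ p| ≤ B) (hB₂ : ∀ p, |N₂ p| ≤ B) :
    ∃ F G : ℝ → ℝ → ℝ, ∃ C lam : ℝ, (∀ x, Continuous (F x) ∧ Continuous (G x) ∧
      ∀ r, F x r = avgInt 2 (fun s => N₁ (F x s, G x s)) r ∧
        G x r = x + avgInt 0 (fun s => N₂ (F x s, G x s)) r) ∧
      ∀ x y r, |F x r - F y r| ≤ C * exp (lam * max r 0) * |x - y| ∧
        |G x r - G y r| ≤ C * exp (lam * max r 0) * |x - y| := by
  have hc : ∀ N : ℝ × ℝ → ℝ, (∀ p q, |N p - N q| ≤ L * ‖p - q‖) → Continuous N := by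
    intro N h
    have : LipschitzWith (Real.toNNReal L) N := by
      refine LipschitzWith.of_dist_le_mul fun p q => ?_
      rw [Real.coe_toNNReal _ hL.le, dist_eq_norm, dist_eq_norm]
      exact h p q
    exact this.continuous
  have hc₁ := hc N₁ h₁
  have hc₂ := hc N₂ h₂
  have hB : 0 ≤ B := (abs_nonneg _).trans (hB₁ 0)
  set lam : ℝ := 2 * L with hlam
  have hlam0 : 0 < lam := by positivity
  let u : (ℝ →ᵇ ℝ × ℝ) → ℝ → ℝ × ℝ := fun v s => exp (lam * max s 0) • v s
  have hu : ∀ v, Continuous (u v) := fun v => by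
    have := v.continuous
    fun_prop
  let P : ℝ → (ℝ →ᵇ ℝ × ℝ) → ℝ → ℝ × ℝ := fun x v r =>
    exp (-(lam * max r 0)) • (avgInt 2 (fun s => N₁ (u v s)) r,
      x + avgInt 0 (fun s => N₂ (u v s)) r)
  have hav : ∀ (N : ℝ × ℝ → ℝ) p v, Continuous N →
      Continuous (avgInt p (fun s => N (u v s))) := fun N p v hN =>
    continuous_avgInt (hN.comp (hu v)) p
  have hPc : ∀ x v, Continuous (P x v) := fun x v => by
    have e1 := hav N₁ 2 v hc₁
    have e2 := hav N₂ 0 v hc₂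
    fun_prop
  have hbd : ∀ (N : ℝ × ℝ → ℝ) p v r, Continuous N → (∀ q, |N q| ≤ B) →
      |avgInt p (fun s => N (u v s)) r| ≤ B / lam * exp (lam * max r 0) := by
    intro N p v r hN hNB
    have := abs_avgInt_sub_le (N' := fun _ => 0) (hN.comp (hu v)) continuous_const p hlam0 hB
      (fun s hs => by
        simp only [Function.comp, sub_zero]
        refine (hNB _).trans (le_mul_of_one_le_right hB ?_)
        exact one_le_exp (by positivity)) r
    simpa [avgInt, Function.comp] using this
  have hexp : ∀ r, exp (-(lam * max r 0)) * exp (lam * max r 0) = 1 := fun r => by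
    rw [← exp_add]; simp
  have hexp1 : ∀ r, exp (-(lam * max r 0)) ≤ 1 := fun r => by
    rw [exp_le_one_iff]
    have : 0 ≤ lam * max r 0 := by positivity
    linarith
  have hPb : ∀ x v r, ‖P x v r‖ ≤ |x| + B / lam := by
    intro x v r
    have hx := abs_nonneg x
    have hBl : 0 ≤ B / lam := by positivity
    have key : ∀ y, |y| ≤ B / lam * exp (lam * max r 0) →
        exp (-(lam * max r 0)) * |y| ≤ B / lam := fun y hy => by
      calc _ ≤ exp (-(lam * max r 0)) * (B / lam * exp (lam * max r 0)) := by gcongr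
        _ = B / lam * (exp (-(lam * max r 0)) * exp (lam * max r 0)) := by ring
        _ = _ := by rw [hexp, mul_one]
    rw [norm_prod_le_iff]
    simp only [P, Prod.smul_fst, Prod.smul_snd, smul_eq_mul, norm_mul, Real.norm_eq_abs, abs_exp]
    constructor
    · have := key _ (hbd N₁ 2 v r hc₁ hB₁)
      linarith
    · have := key _ (hbd N₂ 0 v r hc₂ hB₂)
      have h3 := abs_add_le x (avgInt 0 (fun s => N₂ (u v s)) r)
      calc _ ≤ exp (-(lam * max r 0)) * (|x| + |avgInt 0 (fun s => N₂ (u v s)) r|) := by gcongr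
        _ = exp (-(lam * max r 0)) * |x| + exp (-(lam * max r 0)) * _ := mul_add _ _ _
        _ ≤ 1 * |x| + B / lam := by
          gcongr
          exact hexp1 r
        _ = _ := by ring
  let T : ℝ → (ℝ →ᵇ ℝ × ℝ) → (ℝ →ᵇ ℝ × ℝ) := fun x v =>
    BoundedContinuousFunction.ofNormedAddCommGroup (P x v) (hPc x v) (|x| + B / lam) (hPb x v)
  have hTa : ∀ x v r, T x v r = P x v r := fun _ _ _ => rfl
  have hT : ∀ x, ContractingWith (1 / 2) (T x) := by
    intro x
    refine ⟨by norm_num, LipschitzWith.of_dist_le_mul fun v v' => ?_⟩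
    rw [BoundedContinuousFunction.dist_le (by positivity)]
    intro r
    have key : ∀ (N : ℝ × ℝ → ℝ) p, Continuous N → (∀ p q, |N p - N q| ≤ L * ‖p - q‖) →
        exp (-(lam * max r 0)) * |avgInt p (fun s => N (u v s)) r -
          avgInt p (fun s => N (u v' s)) r| ≤ 1 / 2 * dist v v' := by
      intro N p hN hNL
      have := abs_avgInt_sub_le (hN.comp (hu v)) (hN.comp (hu v')) p hlam0
        (C := L * dist v v') (by positivity) (fun s hs => by
          simp only [Function.comp]
          refine (hNL _ _).trans ?_
          simp only [u]
          rw [← smul_sub, norm_smul, Real.norm_eq_abs, abs_exp, max_eq_left hs, ← dist_eq_norm]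
          have := v.dist_coe_le_dist (g := v') s
          calc _ ≤ L * (exp (lam * s) * dist v v') := by gcongr
            _ = _ := by ring) r
      calc _ ≤ exp (-(lam * max r 0)) * (L * dist v v' / lam * exp (lam * max r 0)) := by
            gcongr
            exact this
        _ = L * dist v v' / lam * (exp (-(lam * max r 0)) * exp (lam * max r 0)) := by ring
        _ = _ := by rw [hexp, hlam]; field_simp
    rw [dist_eq_norm, hTa, hTa, norm_prod_le_iff]
    simp only [P, ← smul_sub, Prod.smul_fst, Prod.smul_snd, smul_eq_mul, norm_mul,
      Real.norm_eq_abs, abs_exp, Prod.fst_sub, Prod.snd_sub, add_sub_add_left_eq_sub]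
    exact ⟨key N₁ 2 hc₁ h₁, key N₂ 0 hc₂ h₂⟩
  let V : ℝ → (ℝ →ᵇ ℝ × ℝ) := fun x => ContractingWith.fixedPoint (T x) (hT x)
  have hV : ∀ x, T x (V x) = V x := fun x => (hT x).fixedPoint_isFixedPt
  have hVr : ∀ x r, u (V x) r = (avgInt 2 (fun s => N₁ (u (V x) s)) r,
      x + avgInt 0 (fun s => N₂ (u (V x) s)) r) := by
    intro x r
    have : V x r = P x (V x) r := by rw [← hTa, hV]
    change exp (lam * max r 0) • V x r = _
    rw [this]
    simp only [P]
    rw [smul_smul, mul_comm, hexp, one_smul]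
  have hVd : ∀ x y, dist (V x) (V y) ≤ 2 * |x - y| := by
    intro x y
    have := (hT x).dist_fixedPoint_fixedPoint_of_dist_le' (T y) (hV x) (hV y)
      (C := |x - y|) (fun v => by
        rw [BoundedContinuousFunction.dist_le (abs_nonneg _)]
        intro r
        rw [dist_eq_norm, hTa, hTa, norm_prod_le_iff]
        simp only [P, ← smul_sub, Prod.smul_fst, Prod.smul_snd, smul_eq_mul, norm_mul,
          Real.norm_eq_abs, abs_exp, Prod.fst_sub, Prod.snd_sub, add_sub_add_right_eq_sub,
          sub_self, abs_zero, mul_zero]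
        exact ⟨abs_nonneg _, mul_le_of_le_one_left (abs_nonneg _) (hexp1 r)⟩)
    refine this.trans (le_of_eq ?_)
    norm_num
    ring
  have hud : ∀ x y r, ‖u (V x) r - u (V y) r‖ ≤ 2 * exp (lam * max r 0) * |x - y| := by
    intro x y r
    simp only [u]
    rw [← smul_sub, norm_smul, Real.norm_eq_abs, abs_exp, ← dist_eq_norm]
    have := ((V x).dist_coe_le_dist (g := V y) r).trans (hVd x y)
    calc _ ≤ exp (lam * max r 0) * (2 * |x - y|) := by gcongr
      _ = _ := by ring
  refine ⟨fun x r => (u (V x) r).1, fun x r => (u (V x) r).2, 2, lam, fun x => ⟨?_, ?_, ?_⟩, ?_⟩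
  · exact (hu _).fst
  · exact (hu _).snd
  · intro r
    exact ⟨congrArg Prod.fst (hVr x r), congrArg Prod.snd (hVr x r)⟩
  · intro x y r
    have := norm_prod_le_iff.1 (hud x y r)
    exact this

lemma le_of_hasDerivAt_nonneg {φ φ' : ℝ → ℝ} {s t : ℝ} (hst : s ≤ t)
    (hc : ContinuousOn φ (Icc s t)) (hd : ∀ r ∈ Ioo s t, HasDerivAt φ (φ' r) r)
    (h : ∀ r ∈ Ioo s t, 0 ≤ φ' r) : φ s ≤ φ t := by
  have hm : MonotoneOn φ (Icc s t) := by
    refine monotoneOn_of_deriv_nonneg (convex_Icc s t) hc ?_ ?_ <;> rw [interior_Icc]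
    · exact fun r hr => (hd r hr).differentiableAt.differentiableWithinAt
    · exact fun r hr => by rw [(hd r hr).deriv]; exact h r hr
  exact hm (left_mem_Icc.2 hst) (right_mem_Icc.2 hst) hst

lemma lt_of_hasDerivAt_pos {φ φ' : ℝ → ℝ} {s t : ℝ} (hst : s < t)
    (hc : ContinuousOn φ (Icc s t)) (hd : ∀ r ∈ Ioo s t, HasDerivAt φ (φ' r) r)
    (h : ∀ r ∈ Ioo s t, 0 < φ' r) : φ s < φ t := by
  have hm : StrictMonoOn φ (Icc s t) := by
    refine strictMonoOn_of_deriv_pos (convex_Icc s t) hc ?_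
    rw [interior_Icc]
    exact fun r hr => by rw [(hd r hr).deriv]; exact h r hr
  exact hm (left_mem_Icc.2 hst.le) (right_mem_Icc.2 hst.le) hst

lemma hasDerivAt_Ham {a b r : ℝ} {f g : ℝ → ℝ}
    (hf : HasDerivAt f (g r * ((f r) ^ 2 - a * (g r) ^ 2 + b) - 2 / r * f r) r)
    (hg : HasDerivAt g (f r * (1 - (g r) ^ 2)) r) :
    HasDerivAt (fun r => Ham a b (f r) (g r)) (-(2 / r * (f r ^ 2 * (1 - g r ^ 2)))) r := by
  unfold Ham
  refine ((((hf.pow 2).const_mul (1 / 2)).mul ((hg.pow 2).const_sub 1)).add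
    ((hg.pow 4).const_mul (a / 4))).sub ((hg.pow 2).const_mul (b / 2)) |>.congr_deriv ?_
  simp only [Pi.pow_apply]
  push_cast
  ring

lemma Ham_eq (a b f g : ℝ) :
    a / 4 - b / 2 - Ham a b f g = (1 - g ^ 2) * (a * (1 + g ^ 2) - 2 * b - 2 * f ^ 2) / 4 := by
  unfold Ham
  ring

/-- A global trajectory of the Cauchy problem that stays in the interior of the admissible
region, extended by its initial value to negative arguments. -/
structure Traj (a b x : ℝ) (f g : ℝ → ℝ) : Prop where
  hb : 0 < b
  hab : 2 * b < a
  hx : x ∈ Ioo (0 : ℝ) 1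
  cf : Continuous f
  cg : Continuous g
  neg : ∀ r ≤ 0, f r = 0 ∧ g r = x
  df : ∀ r, 0 < r → HasDerivAt f (g r * ((f r) ^ 2 - a * (g r) ^ 2 + b) - 2 / r * f r) r
  dg : ∀ r, 0 < r → HasDerivAt g (f r * (1 - (g r) ^ 2)) r
  hg : ∀ r, 0 ≤ r → g r ^ 2 < 1
  hf : ∀ r, 0 ≤ r → 2 * f r ^ 2 < a * (1 + g r ^ 2) - 2 * b

/-- Truncation of the real line to `[-M, M]`. -/
def clamp (M y : ℝ) : ℝ := max (-M) (min M y)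

lemma abs_clamp_le {M : ℝ} (hM : 0 ≤ M) (y : ℝ) : |clamp M y| ≤ M := by
  unfold clamp
  rw [abs_le]
  exact ⟨le_max_left _ _, max_le (by linarith) (min_le_left _ _)⟩

lemma clamp_eq {M y : ℝ} (h : |y| ≤ M) : clamp M y = y := by
  unfold clamp
  rw [abs_le] at h
  rw [min_eq_right h.2, max_eq_right h.1]

lemma abs_clamp_sub_le (M y z : ℝ) : |clamp M y - clamp M z| ≤ |y - z| := by
  unfold clamp
  refine (abs_max_sub_max_le_max _ _ _ _).trans ?_
  refine max_le (by simp) ((abs_min_sub_min_le_max _ _ _ _).trans ?_)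
  simp

lemma truncated_field_bounds {a b M : ℝ} (hb : 0 < b) (ha : 0 < a) (hM : 0 ≤ M) :
    ∃ L B : ℝ, 0 < L ∧ ∀ p q : ℝ × ℝ,
      |clamp 1 p.2 * (clamp M p.1 ^ 2 - a * clamp 1 p.2 ^ 2 + b) -
        clamp 1 q.2 * (clamp M q.1 ^ 2 - a * clamp 1 q.2 ^ 2 + b)| ≤ L * ‖p - q‖ ∧
      |clamp M p.1 * (1 - clamp 1 p.2 ^ 2) - clamp M q.1 * (1 - clamp 1 q.2 ^ 2)|
        ≤ L * ‖p - q‖ ∧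
      |clamp 1 p.2 * (clamp M p.1 ^ 2 - a * clamp 1 p.2 ^ 2 + b)| ≤ B ∧
      |clamp M p.1 * (1 - clamp 1 p.2 ^ 2)| ≤ B := by
  refine ⟨(M ^ 2 + b + 2 * M + 3 * a) + (1 + 2 * M), (M ^ 2 + a + b) + M * 2, by positivity, ?_⟩
  intro p q
  have hd1 := (abs_clamp_sub_le M p.1 q.1).trans (norm_fst_le (p - q))
  have hd2 := (abs_clamp_sub_le 1 p.2 q.2).trans (norm_snd_le (p - q))
  have hp1 := abs_clamp_le hM p.1
  have hq1 := abs_clamp_le hM q.1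
  have hp2 := abs_clamp_le zero_le_one p.2
  have hq2 := abs_clamp_le zero_le_one q.2
  set d := ‖p - q‖
  have hd : 0 ≤ d := norm_nonneg _
  generalize clamp M p.1 = f at *
  generalize clamp M q.1 = f' at *
  generalize clamp 1 p.2 = g at *
  generalize clamp 1 q.2 = g' at *
  have e1 : |f + f'| ≤ 2 * M := (abs_add_le _ _).trans (by linarith)
  have e2 : |g + g'| ≤ 2 := (abs_add_le _ _).trans (by linarith)
  have hgsq : |g| ^ 2 ≤ 1 := pow_le_one₀ (abs_nonneg _) hp2
  have hgsq' : |g'| ^ 2 ≤ 1 := pow_le_one₀ (abs_nonneg _) hq2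
  have hfsq : |f| ^ 2 ≤ M ^ 2 := by gcongr
  have e3 : |g ^ 2 + g * g' + g' ^ 2| ≤ 3 := by
    refine (abs_add_three _ _ _).trans ?_
    rw [abs_pow, abs_pow, abs_mul]
    have : |g| * |g'| ≤ 1 := mul_le_one₀ hp2 (abs_nonneg _) hq2
    linarith
  have e4 : |f ^ 2 + b| ≤ M ^ 2 + b := by
    refine (abs_add_le _ _).trans ?_
    rw [abs_pow, abs_of_pos hb]
    linarith
  have e5 : |1 - g ^ 2| ≤ 1 := by
    rw [abs_le, ← sq_abs]
    constructor <;> nlinarith [sq_nonneg |g|]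
  refine ⟨?_, ?_, ?_, ?_⟩
  · have : g * (f ^ 2 - a * g ^ 2 + b) - g' * (f' ^ 2 - a * g' ^ 2 + b) =
        (g - g') * (f ^ 2 + b) + g' * (f + f') * (f - f') +
          -(a * (g - g') * (g ^ 2 + g * g' + g' ^ 2)) := by ring
    rw [this]
    refine (abs_add_three _ _ _).trans ?_
    rw [abs_neg]
    simp only [abs_mul, abs_of_pos ha]
    calc _ ≤ d * (M ^ 2 + b) + 1 * (2 * M) * d + a * d * 3 := by gcongr
      _ ≤ _ := by nlinarith [mul_nonneg hM hd]
  · have : f * (1 - g ^ 2) - f' * (1 - g' ^ 2) =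
        (f - f') * (1 - g ^ 2) + -(f' * (g - g') * (g + g')) := by ring
    rw [this]
    refine (abs_add_le _ _).trans ?_
    rw [abs_neg]
    simp only [abs_mul]
    calc _ ≤ d * 1 + M * d * 2 := by gcongr
      _ ≤ _ := by nlinarith [mul_nonneg hM hd, mul_nonneg (sq_nonneg M) hd, mul_nonneg hb.le hd,
                    mul_nonneg ha.le hd]
  · rw [abs_mul]
    have : |f ^ 2 - a * g ^ 2 + b| ≤ M ^ 2 + a + b := by
      rw [abs_le]
      rw [sq_abs] at hfsq hgsq
      constructor <;> nlinarith [sq_nonneg f, sq_nonneg g]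
    calc _ ≤ 1 * (M ^ 2 + a + b) := by gcongr
      _ ≤ _ := by linarith
  · rw [abs_mul]
    calc _ ≤ M * 1 := by gcongr
      _ ≤ _ := by nlinarith [sq_nonneg M]

lemma continuous_uncurry_of_lipschitz {F : ℝ → ℝ → ℝ} {C lam : ℝ} (hF : ∀ x, Continuous (F x))
    (h : ∀ x y r, |F x r - F y r| ≤ C * exp (lam * max r 0) * |x - y|) :
    Continuous fun p : ℝ × ℝ => F p.1 p.2 := by
  rw [continuous_iff_continuousAt]
  rintro ⟨x, r⟩
  have h2 : Tendsto (fun p : ℝ × ℝ => F x p.2) (𝓝 (x, r)) (𝓝 (F x r)) :=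
    ((hF x).comp continuous_snd).tendsto (x, r)
  have h1 : Tendsto (fun p : ℝ × ℝ => F p.1 p.2 - F x p.2) (𝓝 (x, r)) (𝓝 0) := by
    refine squeeze_zero_norm (a := fun p : ℝ × ℝ => C * exp (lam * max p.2 0) * |p.1 - x|)
      (fun p => h _ _ _) ?_
    have : Continuous fun p : ℝ × ℝ => C * exp (lam * max p.2 0) * |p.1 - x| := by fun_prop
    have := this.tendsto (x, r)
    simpa using this
  simpa [ContinuousAt] using h1.add h2

lemma hasDerivAt_of_avgInt_two {f N : ℝ → ℝ} (hN : Continuous N) (h : ∀ r, f r = avgInt 2 N r)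
    {r : ℝ} (hr : 0 < r) : HasDerivAt f (N r - 2 / r * f r) r := by
  have hi : HasDerivAt (fun t => ∫ s in (0 : ℝ)..t, s ^ 2 * N s) (r ^ 2 * N r) r := by
    have hc : Continuous fun s => s ^ 2 * N s := by fun_prop
    exact hc.deriv_integral _ 0 r ▸ (intervalIntegral.differentiable_integral_of_continuous hc r).hasDerivAt
  have hq := hi.div (hasDerivAt_pow 2 r) (by positivity)
  have hfr : r ^ 2 * f r = ∫ s in (0 : ℝ)..r, s ^ 2 * N s := by rw [h, avgInt_eq 2 hr.le]
  have := hq.congr_of_eventuallyEq (f₁ := f) (by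
    filter_upwards [lt_mem_nhds hr] with t ht
    simp only [Pi.div_apply]
    rw [h, ← avgInt_eq 2 ht.le]
    field_simp)
  refine this.congr_deriv ?_
  rw [← hfr]
  push_cast
  field_simp

lemma hasDerivAt_of_avgInt_zero {g N : ℝ → ℝ} {x : ℝ} (hN : Continuous N)
    (h : ∀ r, g r = x + avgInt 0 N r) {r : ℝ} (hr : 0 < r) : HasDerivAt g (N r) r := by
  have hi : HasDerivAt (fun t => x + ∫ s in (0 : ℝ)..t, N s) (N r) r :=
    (hN.deriv_integral _ 0 r ▸
      (intervalIntegral.differentiable_integral_of_continuous hN r).hasDerivAt).const_add x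
  refine hi.congr_of_eventuallyEq ?_
  filter_upwards [lt_mem_nhds hr] with t ht
  rw [h]
  have := avgInt_eq (N := N) 0 ht.le
  simp only [pow_zero, one_mul] at this
  rw [this]

/-- The truncated flow never leaves the admissible region, where it solves the true system. -/
lemma truncated_invariant {a b x M : ℝ} {f g : ℝ → ℝ} (hb : 0 < b) (hab : 2 * b < a)
    (hx : x ∈ Ioo (0 : ℝ) 1) (hM : 0 ≤ M) (hMsq : M ^ 2 = a - b) (cf : Continuous f)
    (cg : Continuous g) (f0 : f 0 = 0) (g0 : g 0 = x)
    (df : ∀ r, 0 < r → HasDerivAt f (clamp 1 (g r) * (clamp M (f r) ^ 2 -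
      a * clamp 1 (g r) ^ 2 + b) - 2 / r * f r) r)
    (dg : ∀ r, 0 < r → HasDerivAt g (clamp M (f r) * (1 - clamp 1 (g r) ^ 2)) r) :
    ∀ r, 0 ≤ r → g r ^ 2 < 1 ∧ 2 * f r ^ 2 < a * (1 + g r ^ 2) - 2 * b := by
  by_contra! hne
  set S : Set ℝ := {r | 0 ≤ r ∧ (1 ≤ g r ^ 2 ∨ a * (1 + g r ^ 2) - 2 * b ≤ 2 * f r ^ 2)} with hS
  have hSc : IsClosed S := by
    refine (isClosed_le continuous_const continuous_id).inter (IsClosed.union ?_ ?_)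
    · exact isClosed_le continuous_const (cg.pow 2)
    · exact isClosed_le (by fun_prop : Continuous fun r => a * (1 + g r ^ 2) - 2 * b)
        (by fun_prop : Continuous fun r => 2 * f r ^ 2)
  have hSn : S.Nonempty := by
    obtain ⟨r, hr, h⟩ := hne
    refine ⟨r, hr, ?_⟩
    by_contra! hcon
    exact absurd (h hcon.1) (not_le.2 hcon.2)
  have hSb : BddBelow S := ⟨0, fun r hr => hr.1⟩
  set t := sInf S
  have htS : t ∈ S := hSc.csInf_mem hSn hSb
  have hgood : ∀ r, 0 ≤ r → r < t → g r ^ 2 < 1 ∧ 2 * f r ^ 2 < a * (1 + g r ^ 2) - 2 * b := by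
    intro r hr hrt
    by_contra hcon
    refine absurd (csInf_le hSb (⟨hr, ?_⟩ : r ∈ S)) (not_le.2 hrt)
    by_contra! h'
    exact hcon h'
  have hcl : ∀ r, 0 ≤ r → r < t → clamp M (f r) = f r ∧ clamp 1 (g r) = g r ∧ |f r| ≤ M := by
    intro r hr hrt
    obtain ⟨h1, h2⟩ := hgood r hr hrt
    have h3 : |f r| ≤ M := abs_le_of_sq_le_sq (by nlinarith) hM
    exact ⟨clamp_eq h3, clamp_eq (abs_le_of_sq_le_sq (by linarith) zero_le_one), h3⟩
  have df' : ∀ r ∈ Ioo 0 t, HasDerivAt f (g r * ((f r) ^ 2 - a * (g r) ^ 2 + b) - 2 / r * f r) r := by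
    intro r hr
    obtain ⟨h1, h2, -⟩ := hcl r hr.1.le hr.2
    have := df r hr.1
    rwa [h1, h2] at this
  have dg' : ∀ r ∈ Ioo 0 t, HasDerivAt g (f r * (1 - (g r) ^ 2)) r := by
    intro r hr
    obtain ⟨h1, h2, -⟩ := hcl r hr.1.le hr.2
    have := dg r hr.1
    rwa [h1, h2] at this
  have ht0 : 0 ≤ t := htS.1
  have hx2 : x ^ 2 < 1 := by nlinarith [hx.1, hx.2]
  have hmon1 := le_of_hasDerivAt_nonneg (φ := fun r => (1 - g r ^ 2) * exp (2 * M * r)) ht0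
    (by fun_prop)
    (fun r hr => (((dg' r hr).pow 2).const_sub 1).mul
      (((hasDerivAt_id r).const_mul (2 * M)).exp))
    (by
      intro r hr
      obtain ⟨h1, h2⟩ := hgood r hr.1.le hr.2
      obtain ⟨-, -, h3⟩ := hcl r hr.1.le hr.2
      have h4 : |g r * f r| ≤ 1 * M := by
        rw [abs_mul]
        gcongr
        exact abs_le_of_sq_le_sq (by linarith) zero_le_one
      have h5 := le_abs_self (g r * f r)
      have h6 : 0 ≤ 2 * exp (2 * M * r) * (1 - g r ^ 2) * (M - g r * f r) := by
        have : 0 ≤ 1 - g r ^ 2 := by linarith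
        have : 0 ≤ M - g r * f r := by linarith
        positivity
      simp only [Pi.pow_apply, id]
      push_cast
      linarith)
  have hmon2 := le_of_hasDerivAt_nonneg (φ := fun r => -Ham a b (f r) (g r)) ht0
    (by unfold Ham; fun_prop)
    (fun r hr => (hasDerivAt_Ham (df' r hr) (dg' r hr)).neg)
    (by
      intro r hr
      obtain ⟨h1, h2⟩ := hgood r hr.1.le hr.2
      have : 0 ≤ 1 - g r ^ 2 := by linarith
      have := hr.1
      rw [neg_neg]
      positivity)
  have e1 : 0 < 1 - g t ^ 2 := by
    simp only [g0, mul_zero, exp_zero, mul_one] at hmon1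
    exact pos_of_mul_pos_left (lt_of_lt_of_le (by linarith) hmon1) (exp_pos _).le
  have e2 := Ham_eq a b (f t) (g t)
  have e3 := Ham_eq a b (f 0) (g 0)
  rw [f0, g0] at e3
  simp only [f0, g0] at hmon2
  have e4 : 0 < (1 - x ^ 2) * (a * (1 + x ^ 2) - 2 * b - 2 * 0 ^ 2) / 4 := by
    have : 0 < a * (1 + x ^ 2) - 2 * b - 2 * 0 ^ 2 := by nlinarith [sq_nonneg x]
    have : 0 < 1 - x ^ 2 := by linarith
    positivity
  have e5 : 0 < (1 - g t ^ 2) * (a * (1 + g t ^ 2) - 2 * b - 2 * f t ^ 2) := by linarith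
  have e6 := pos_of_mul_pos_right e5 e1.le
  rcases htS.2 with h | h <;> linarith

theorem exists_traj {a b : ℝ} (hb : 0 < b) (hab : 2 * b < a) :
    ∃ F G : ℝ → ℝ → ℝ, (∀ x ∈ Ioo (0 : ℝ) 1, Traj a b x (F x) (G x)) ∧
      (Continuous fun p : ℝ × ℝ => F p.1 p.2) ∧ Continuous fun p : ℝ × ℝ => G p.1 p.2 := by
  set M := √(a - b) with hM
  have hM0 : 0 ≤ M := sqrt_nonneg _
  have hMsq : M ^ 2 = a - b := sq_sqrt (by linarith)
  obtain ⟨L, B, hL, hLB⟩ := truncated_field_bounds (a := a) hb (by linarith) hM0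
  obtain ⟨F, G, C, lam, hsol, hlip⟩ := exists_integral_solution hL (fun p q => (hLB p q).1)
    (fun p q => (hLB p q).2.1) (fun p => (hLB p p).2.2.1) (fun p => (hLB p p).2.2.2)
  have hcl : ∀ K, Continuous (clamp K) := fun K => by unfold clamp; fun_prop
  refine ⟨F, G, fun x hx => ?_, continuous_uncurry_of_lipschitz (fun x => (hsol x).1)
    (fun x y r => (hlip x y r).1), continuous_uncurry_of_lipschitz (fun x => (hsol x).2.1)
    (fun x y r => (hlip x y r).2)⟩
  obtain ⟨cf, cg, heq⟩ := hsol x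
  have hneg : ∀ r ≤ 0, F x r = 0 ∧ G x r = x := by
    intro r hr
    rw [(heq r).1, (heq r).2]
    simp [avgInt, max_eq_right hr]
  have hcl1 := hcl 1
  have hclM := hcl M
  have df : ∀ r, 0 < r → HasDerivAt (F x) (clamp 1 (G x r) * (clamp M (F x r) ^ 2 -
      a * clamp 1 (G x r) ^ 2 + b) - 2 / r * F x r) r := fun r hr =>
    hasDerivAt_of_avgInt_two (N := fun r => clamp 1 (G x r) * (clamp M (F x r) ^ 2 -
      a * clamp 1 (G x r) ^ 2 + b)) (by fun_prop) (fun r => (heq r).1) hr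
  have dg : ∀ r, 0 < r → HasDerivAt (G x) (clamp M (F x r) * (1 - clamp 1 (G x r) ^ 2)) r :=
    fun r hr => hasDerivAt_of_avgInt_zero (N := fun r => clamp M (F x r) *
      (1 - clamp 1 (G x r) ^ 2)) (by fun_prop) (fun r => (heq r).2) hr
  have hinv := truncated_invariant hb hab hx hM0 hMsq cf cg (hneg 0 le_rfl).1 (hneg 0 le_rfl).2
    df dg
  have hcl' : ∀ r, 0 < r → clamp M (F x r) = F x r ∧ clamp 1 (G x r) = G x r := by
    intro r hr
    obtain ⟨h1, h2⟩ := hinv r hr.le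
    exact ⟨clamp_eq (abs_le_of_sq_le_sq (by nlinarith) hM0),
      clamp_eq (abs_le_of_sq_le_sq (by linarith) zero_le_one)⟩
  refine ⟨hb, hab, hx, cf, cg, hneg, fun r hr => ?_, fun r hr => ?_, fun r hr => (hinv r hr).1,
    fun r hr => (hinv r hr).2⟩
  · have := df r hr
    rwa [(hcl' r hr).1, (hcl' r hr).2] at this
  · have := dg r hr
    rwa [(hcl' r hr).1, (hcl' r hr).2] at this

lemma crossing {φ φ' : ℝ → ℝ} {c s t : ℝ} (hst : s < t) (hφ : ∀ r, HasDerivAt φ (φ' r) r)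
    (hs : c ≤ φ s) (hpos : ∀ r ∈ Icc s t, φ r = c → 0 < φ' r) : c < φ t := by
  have hle : ∀ ⦃r⦄, r ∈ Icc s t → c ≤ φ r :=
    image_le_of_deriv_right_lt_deriv_boundary (f := fun _ => c) (f' := fun _ => 0)
      continuousOn_const (fun r _ => (hasDerivAt_const r c).hasDerivWithinAt) hs hφ
      (fun r hr h => hpos r ⟨hr.1, hr.2.le⟩ h.symm)
  refine lt_of_le_of_ne (hle ⟨hst.le, le_rfl⟩) fun h => ?_
  have hd := hpos t ⟨hst.le, le_rfl⟩ h.symm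
  have hder : deriv (fun r => φ r - c) t = φ' t := ((hφ t).sub_const c).deriv
  have hev := eventually_nhdsWithin_sign_eq_of_deriv_pos (f := fun r => φ r - c) (x₀ := t)
    (by rw [hder]; exact hd) (by simp [h])
  have h1 : ∀ᶠ r in 𝓝[<] t, SignType.sign (φ r - c) = SignType.sign (r - t) :=
    nhdsWithin_le_nhds hev
  obtain ⟨r, hr1, hr2⟩ := (h1.and (Ioo_mem_nhdsLT hst)).exists
  rw [sign_neg (sub_neg.2 hr2.2), sign_eq_neg_one_iff] at hr1
  have := hle ⟨hr2.1.le, hr2.2.le⟩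
  linarith

/-- The angular velocity of the plane curve `(g, -r² f)`. -/
def angleRate (a b : ℝ) (f g : ℝ → ℝ) (r : ℝ) : ℝ :=
  (r ^ 2 * f r * (f r * (1 - g r ^ 2)) - r ^ 2 * (g r * (f r ^ 2 - a * g r ^ 2 + b)) * g r) /
    ((r ^ 2 * f r) ^ 2 + g r ^ 2)

/-- The continuous angle of the plane curve `(g, -r² f)`. -/
def angle (a b : ℝ) (f g : ℝ → ℝ) (r : ℝ) : ℝ := ∫ s in (0 : ℝ)..r, angleRate a b f g s

namespace Traj

variable {a b x : ℝ} {f g : ℝ → ℝ}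

lemma f_zero (T : Traj a b x f g) : f 0 = 0 := (T.neg 0 le_rfl).1

lemma g_zero (T : Traj a b x f g) : g 0 = x := (T.neg 0 le_rfl).2

lemma continuous_Ham (T : Traj a b x f g) : Continuous fun r => Ham a b (f r) (g r) := by
  have := T.cf
  have := T.cg
  unfold Ham
  fun_prop

lemma Ham_le (T : Traj a b x f g) {s t : ℝ} (hs : 0 ≤ s) (hst : s ≤ t) :
    Ham a b (f t) (g t) ≤ Ham a b (f s) (g s) := by
  have := le_of_hasDerivAt_nonneg (φ := fun r => -Ham a b (f r) (g r)) hst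
    T.continuous_Ham.neg.continuousOn
    (fun r hr => (hasDerivAt_Ham (T.df r (hs.trans_lt hr.1)) (T.dg r (hs.trans_lt hr.1))).neg)
    (by
      intro r hr
      have h0 := hs.trans_lt hr.1
      have : 0 ≤ 1 - g r ^ 2 := by linarith [T.hg r h0.le]
      rw [neg_neg]
      positivity)
  linarith

lemma sq_f_lt (T : Traj a b x f g) {r : ℝ} (hr : 0 ≤ r) : f r ^ 2 < a - b := by
  have := T.hg r hr
  have := T.hf r hr
  have := T.hb
  have := T.hab
  nlinarith

lemma abs_f_le (T : Traj a b x f g) {r : ℝ} (hr : 0 ≤ r) : |f r| ≤ √(a - b) := by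
  rw [← sqrt_sq_eq_abs]
  exact sqrt_le_sqrt (T.sq_f_lt hr).le

lemma abs_g_le (T : Traj a b x f g) {r : ℝ} (hr : 0 ≤ r) : |g r| ≤ 1 :=
  abs_le_of_sq_le_sq (by linarith [T.hg r hr]) zero_le_one

lemma exists_gap (T : Traj a b x f g) : ∃ δ > 0, ∀ r, 0 ≤ r → δ ≤ 1 - g r ^ 2 := by
  have hb := T.hb
  have hab := T.hab
  have hx := T.hx
  set A := (1 - x ^ 2) * (a * (1 + x ^ 2) - 2 * b) with hA
  have hA0 : 0 < A := by
    have : 0 < 1 - x ^ 2 := by nlinarith [hx.1, hx.2]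
    have : 0 < a * (1 + x ^ 2) - 2 * b := by nlinarith [sq_nonneg x]
    positivity
  have hB0 : 0 < 2 * a := by linarith
  refine ⟨A / (2 * a), by positivity, fun r hr => ?_⟩
  rw [div_le_iff₀ hB0]
  have h1 := T.Ham_le le_rfl hr
  have h2 := Ham_eq a b (f r) (g r)
  have h3 := Ham_eq a b (f 0) (g 0)
  rw [T.f_zero, T.g_zero] at h1 h3
  have h4 : A ≤ (1 - g r ^ 2) * (a * (1 + g r ^ 2) - 2 * b - 2 * f r ^ 2) := by
    rw [hA]
    linarith
  refine h4.trans ?_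
  have := T.hg r hr
  gcongr
  nlinarith [sq_nonneg (f r), T.hb, T.hab]

lemma f_ne_zero_or_g_ne_zero (T : Traj a b x f g) {r : ℝ} (hr : 0 < r) : f r ≠ 0 ∨ g r ≠ 0 := by
  by_contra! hcon
  have hb := T.hb
  have hab := T.hab
  have cf := T.cf
  have cg := T.cg
  set K := 2 * a + 1 with hK
  have hz : ∀ s ∈ Ioo 0 r, g s = 0 := by
    intro s hs
    have hmon := le_of_hasDerivAt_nonneg
      (φ := fun t => (f t ^ 2 + g t ^ 2) * (t ^ 4 * exp (K * t))) hs.2.le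
      (by fun_prop)
      (fun t ht => (((T.df t (hs.1.trans ht.1)).pow 2).add ((T.dg t (hs.1.trans ht.1)).pow 2)).mul
        ((hasDerivAt_pow 4 t).mul (((hasDerivAt_id t).const_mul K).exp)))
      (by
        intro t ht
        have ht0 : 0 < t := hs.1.trans ht.1
        have h1 := T.hg t ht0.le
        have h2 := T.sq_f_lt ht0.le
        simp only [Pi.pow_apply, Pi.add_apply, Pi.mul_apply, id]
        push_cast
        set P := f t ^ 2 - a * g t ^ 2 + b + (1 - g t ^ 2) with hP
        have hPK : |P| ≤ K := by
          rw [abs_le]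
          constructor <;> nlinarith [sq_nonneg (f t), sq_nonneg (g t)]
        have h3 : 0 ≤ K * (f t ^ 2 + g t ^ 2) + 2 * (f t * g t) * P := by
          have h4 : |2 * (f t * g t)| ≤ f t ^ 2 + g t ^ 2 := by
            rw [abs_le]
            constructor <;> nlinarith [sq_nonneg (f t + g t), sq_nonneg (f t - g t)]
          have h5 : |2 * (f t * g t) * P| ≤ (f t ^ 2 + g t ^ 2) * K := by
            rw [abs_mul]
            gcongr
          have := neg_abs_le (2 * (f t * g t) * P)
          linarith
        have h6 : 0 ≤ t ^ 4 * exp (K * t) *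
            (K * (f t ^ 2 + g t ^ 2) + 2 * (f t * g t) * P + 4 / t * g t ^ 2) := by positivity
        refine h6.trans (le_of_eq ?_)
        rw [hP]
        field_simp
        ring)
    simp only [hcon.1, hcon.2] at hmon
    have h0 : 0 < s ^ 4 * exp (K * s) := by
      have := hs.1
      positivity
    have h1 : f s ^ 2 + g s ^ 2 ≤ 0 := by
      by_contra! h
      have := mul_pos h h0
      norm_num at hmon
      linarith
    have : g s ^ 2 = 0 := by nlinarith [sq_nonneg (f s), sq_nonneg (g s)]
    exact pow_eq_zero_iff (two_ne_zero) |>.1 this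
  have h1 : Tendsto g (𝓝[>] 0) (𝓝 x) := by
    have := cg.tendsto 0
    rw [T.g_zero] at this
    exact this.mono_left nhdsWithin_le_nhds
  have h2 : Tendsto g (𝓝[>] 0) (𝓝 0) := by
    refine tendsto_const_nhds.congr' ?_
    filter_upwards [Ioo_mem_nhdsGT hr] with s hs
    exact (hz s hs).symm
  exact T.hx.1.ne' (tendsto_nhds_unique h1 h2)

lemma angle_denom_pos (T : Traj a b x f g) (r : ℝ) : 0 < (r ^ 2 * f r) ^ 2 + g r ^ 2 := by
  rcases le_or_gt r 0 with h | h
  · rw [(T.neg r h).2]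
    have := T.hx.1
    positivity
  · rcases T.f_ne_zero_or_g_ne_zero h with h' | h' <;> positivity

lemma continuous_angleRate (T : Traj a b x f g) : Continuous (angleRate a b f g) := by
  have cf := T.cf
  have cg := T.cg
  unfold angleRate
  exact Continuous.div (by fun_prop) (by fun_prop) fun r => (T.angle_denom_pos r).ne'

lemma hasDerivAt_angle (T : Traj a b x f g) (r : ℝ) :
    HasDerivAt (angle a b f g) (angleRate a b f g r) r :=
  T.continuous_angleRate.deriv_integral _ 0 r ▸
    (intervalIntegral.differentiable_integral_of_continuous T.continuous_angleRate r).hasDerivAt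

lemma continuous_angle (T : Traj a b x f g) : Continuous (angle a b f g) :=
  continuous_iff_continuousAt.2 fun r => (T.hasDerivAt_angle r).continuousAt

lemma angle_zero : angle a b f g 0 = 0 := by simp [angle]

lemma polar_weighted (T : Traj a b x f g) {r : ℝ} (hr : 0 ≤ r) :
    ∃ ρ > 0, r ^ 2 * f r = -(ρ * sin (angle a b f g r)) ∧ g r = ρ * cos (angle a b f g r) := by
  have cf := T.cf
  have cg := T.cg
  have cθ := T.continuous_angle
  set θ := angle a b f g with hθ
  let E : ℝ → ℝ := fun s => (s ^ 2 * f s) ^ 2 + g s ^ 2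
  let w' : ℝ → ℝ := fun s => s ^ 2 * (g s * (f s ^ 2 - a * g s ^ 2 + b))
  let κ : ℝ → ℝ := fun s => (s ^ 2 * f s * w' s + g s * (f s * (1 - g s ^ 2))) / E s
  have hE : ∀ s, 0 < E s := T.angle_denom_pos
  have cκ : Continuous κ :=
    Continuous.div (by fun_prop) (by fun_prop) fun s => (hE s).ne'
  let η : ℝ → ℝ := fun r => ∫ s in (0 : ℝ)..r, κ s
  have dη : ∀ s, HasDerivAt η (κ s) s := fun s => cκ.deriv_integral _ 0 s ▸
    (intervalIntegral.differentiable_integral_of_continuous cκ s).hasDerivAt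
  have cη : Continuous η := continuous_iff_continuousAt.2 fun s => (dη s).continuousAt
  have dw : ∀ s, 0 < s → HasDerivAt (fun s => s ^ 2 * f s) (w' s) s := fun s hs => by
    refine ((hasDerivAt_pow 2 s).mul (T.df s hs)).congr_deriv ?_
    simp only [w']
    push_cast
    field_simp
    ring
  have rate : ∀ s, angleRate a b f g s * E s =
      s ^ 2 * f s * (f s * (1 - g s ^ 2)) - w' s * g s := fun s => by
    simp only [angleRate]
    exact div_mul_cancel₀ _ (hE s).ne'
  have rκ : ∀ s, κ s * E s = s ^ 2 * f s * w' s + g s * (f s * (1 - g s ^ 2)) := fun s =>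
    div_mul_cancel₀ _ (hE s).ne'
  have hid : ∀ s, w' s + g s * angleRate a b f g s = κ s * (s ^ 2 * f s) ∧
      f s * (1 - g s ^ 2) - s ^ 2 * f s * angleRate a b f g s = κ s * g s := fun s => by
    have h1 := rate s
    have h2 := rκ s
    have h3 : E s = (s ^ 2 * f s) ^ 2 + g s ^ 2 := rfl
    constructor <;> refine mul_right_cancel₀ (hE s).ne' ?_
    · linear_combination (g s) * h1 - (s ^ 2 * f s) * h2 + (w' s) * h3
    · linear_combination -(s ^ 2 * f s) * h1 - g s * h2 + (f s * (1 - g s ^ 2)) * h3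
  have hconst : ∀ (Q : ℝ → ℝ), Continuous Q → (∀ s, 0 < s → HasDerivAt Q (κ s * Q s) s) →
      Q r = Q 0 * exp (η r) := by
    intro Q hQ hQd
    have hd : ∀ s ∈ Ioo 0 r, HasDerivAt (fun s => Q s * exp (-η s)) 0 s := fun s hs => by
      refine ((hQd s hs.1).mul (dη s).neg.exp).congr_deriv ?_
      simp only [Pi.neg_apply]
      ring
    have h1 := le_of_hasDerivAt_nonneg hr (by fun_prop) hd (fun _ _ => le_rfl)
    have h2 := le_of_hasDerivAt_nonneg hr (φ := fun s => -(Q s * exp (-η s))) (by fun_prop)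
      (fun s hs => (hd s hs).neg) (fun _ _ => by simp)
    have h0 : η 0 = 0 := by simp [η]
    have h3 : Q 0 = Q r * exp (-η r) := by
      have := le_antisymm h1 (neg_le_neg_iff.1 h2)
      simpa [h0] using this
    rw [h3, mul_assoc, ← exp_add]
    simp
  have hs1 := hconst (fun s => s ^ 2 * f s * cos (θ s) + g s * sin (θ s)) (by fun_prop)
    (fun s hs => by
      refine (((dw s hs).mul (T.hasDerivAt_angle s).cos).add
        ((T.dg s hs).mul (T.hasDerivAt_angle s).sin)).congr_deriv ?_
      linear_combination cos (θ s) * (hid s).1 + sin (θ s) * (hid s).2)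
  have hs2 := hconst (fun s => g s * cos (θ s) - s ^ 2 * f s * sin (θ s)) (by fun_prop)
    (fun s hs => by
      refine (((T.dg s hs).mul (T.hasDerivAt_angle s).cos).sub
        ((dw s hs).mul (T.hasDerivAt_angle s).sin)).congr_deriv ?_
      linear_combination -sin (θ s) * (hid s).1 + cos (θ s) * (hid s).2)
  have hθ0 : θ 0 = 0 := angle_zero
  simp only [hθ0, T.g_zero, sin_zero, cos_zero] at hs1 hs2
  norm_num at hs1 hs2
  refine ⟨x * exp (η r), mul_pos T.hx.1 (exp_pos _), ?_, ?_⟩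
  · rw [← hs2]
    linear_combination cos (θ r) * hs1 - (r ^ 2 * f r) * sin_sq_add_cos_sq (θ r)
  · rw [← hs2]
    linear_combination sin (θ r) * hs1 - g r * sin_sq_add_cos_sq (θ r)

lemma polar (T : Traj a b x f g) {r : ℝ} (hr : 0 < r) :
    ∃ ρ > 0, ∃ ρ' > 0, f r = -(ρ' * sin (angle a b f g r)) ∧
      g r = ρ * cos (angle a b f g r) := by
  obtain ⟨ρ, hρ, h1, h2⟩ := T.polar_weighted hr.le
  refine ⟨ρ, hρ, ρ / r ^ 2, by positivity, ?_, h2⟩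
  field_simp
  linarith

lemma g_eq_zero_iff (T : Traj a b x f g) {r : ℝ} (hr : 0 ≤ r) :
    g r = 0 ↔ cos (angle a b f g r) = 0 := by
  obtain ⟨ρ, hρ, -, h2⟩ := T.polar_weighted hr
  rw [h2, mul_eq_zero]
  simp [hρ.ne']

lemma f_eq_zero_iff (T : Traj a b x f g) {r : ℝ} (hr : 0 < r) :
    f r = 0 ↔ sin (angle a b f g r) = 0 := by
  obtain ⟨ρ, -, ρ', hρ, h2, -⟩ := T.polar hr
  rw [h2, neg_eq_zero, mul_eq_zero]
  simp [hρ.ne']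

lemma angleRate_pos_of_g_eq_zero (T : Traj a b x f g) {r : ℝ} (hr : 0 < r) (h : g r = 0) :
    0 < angleRate a b f g r := by
  have hf : f r ≠ 0 := by simpa [h] using T.f_ne_zero_or_g_ne_zero hr
  have : angleRate a b f g r = 1 / r ^ 2 := by
    unfold angleRate
    rw [h]
    field_simp
    ring
  rw [this]
  positivity

lemma sq_g_ge_of_f_eq_zero (T : Traj a b x f g) {r : ℝ} (hr : 0 < r) (h : f r = 0)
    (hH : 0 ≤ Ham a b (f r) (g r)) : 2 * b ≤ a * g r ^ 2 := by
  have hg : g r ≠ 0 := by simpa [h] using T.f_ne_zero_or_g_ne_zero hr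
  have hg2 : 0 < g r ^ 2 := by positivity
  unfold Ham at hH
  rw [h] at hH
  by_contra! hcon
  nlinarith

lemma angleRate_pos_of_f_eq_zero (T : Traj a b x f g) {r : ℝ} (hr : 0 < r) (h : f r = 0)
    (hH : 0 ≤ Ham a b (f r) (g r)) : 0 < angleRate a b f g r := by
  have h1 := T.sq_g_ge_of_f_eq_zero hr h hH
  have hg : g r ≠ 0 := by simpa [h] using T.f_ne_zero_or_g_ne_zero hr
  have hb := T.hb
  have : angleRate a b f g r = r ^ 2 * (a * g r ^ 2 - b) := by
    unfold angleRate
    rw [h]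
    field_simp
    ring
  rw [this]
  have : 0 < a * g r ^ 2 - b := by linarith
  positivity

lemma lt_angle_of_cos_eq_zero (T : Traj a b x f g) {s t c : ℝ} (hs : 0 ≤ s) (hst : s < t)
    (hc : cos c = 0) (h : c ≤ angle a b f g s) : c < angle a b f g t := by
  refine crossing hst T.hasDerivAt_angle h fun r hr hrc => ?_
  have hr0 : 0 ≤ r := hs.trans hr.1
  have hg : g r = 0 := (T.g_eq_zero_iff hr0).2 (hrc ▸ hc)
  refine T.angleRate_pos_of_g_eq_zero (lt_of_le_of_ne hr0 ?_) hg
  rintro rfl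
  exact T.hx.1.ne' (T.g_zero ▸ hg)

lemma lt_angle_of_sin_eq_zero (T : Traj a b x f g) {s t c : ℝ} (hs : 0 < s) (hst : s < t)
    (hH : 0 ≤ Ham a b (f t) (g t)) (hc : sin c = 0) (h : c ≤ angle a b f g s) :
    c < angle a b f g t := by
  refine crossing hst T.hasDerivAt_angle h fun r hr hrc => ?_
  have hr0 : 0 < r := hs.trans_le hr.1
  exact T.angleRate_pos_of_f_eq_zero hr0 ((T.f_eq_zero_iff hr0).2 (hrc ▸ hc))
    (hH.trans (T.Ham_le hr0.le hr.2))

lemma angle_pos (T : Traj a b x f g) {t : ℝ} (ht : 0 < t) (hH : 0 ≤ Ham a b (f t) (g t)) :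
    0 < angle a b f g t := by
  have cf := T.cf
  have cg := T.cg
  have hb := T.hb
  have hx := T.hx.1
  have hxb : 2 * b ≤ a * x ^ 2 := by
    have h0 := hH.trans (T.Ham_le le_rfl ht.le)
    rw [T.f_zero, T.g_zero] at h0
    unfold Ham at h0
    by_contra! hcon
    have : 0 < x ^ 2 := by positivity
    nlinarith
  have h1 : ∀ᶠ r in 𝓝 (0 : ℝ), g r * (f r ^ 2 - a * g r ^ 2 + b) < 0 := by
    have hc : Continuous fun r => g r * (f r ^ 2 - a * g r ^ 2 + b) := by fun_prop
    refine (hc.tendsto 0).eventually_lt_const ?_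
    rw [T.f_zero, T.g_zero]
    nlinarith
  have h2 : ∀ᶠ r in 𝓝 (0 : ℝ), -π < angle a b f g r := by
    refine (T.continuous_angle.tendsto 0).eventually_const_lt ?_
    rw [angle_zero]
    linarith [pi_pos]
  obtain ⟨ε, hε, hball⟩ := Metric.eventually_nhds_iff.1 (h1.and h2)
  set s := min (ε / 2) (t / 2) with hs
  have hs0 : 0 < s := by positivity
  have hst : s < t := (min_le_right _ _).trans_lt (by linarith)
  have hsε : s < ε := (min_le_left _ _).trans_lt (by linarith)
  have hw := lt_of_hasDerivAt_pos (φ := fun r => -(r ^ 2 * f r))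
    (φ' := fun r => r ^ 2 * -(g r * (f r ^ 2 - a * g r ^ 2 + b))) hs0
    (by fun_prop)
    (fun r hr => by
      refine ((hasDerivAt_pow 2 r).mul (T.df r hr.1)).neg.congr_deriv ?_
      have := hr.1
      push_cast
      field_simp
      ring)
    (fun r hr => by
      have h3 := (hball (y := r) (by
        rw [dist_zero_right, norm_eq_abs, abs_of_pos hr.1]
        exact hr.2.trans hsε)).1
      have := hr.1
      have : 0 < -(g r * (f r ^ 2 - a * g r ^ 2 + b)) := by linarith
      positivity)
  have hθ := (hball (y := s) (by rwa [dist_zero_right, norm_eq_abs, abs_of_pos hs0])).2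
  obtain ⟨ρ, hρ, h4, -⟩ := T.polar_weighted hs0.le
  have h5 : 0 < sin (angle a b f g s) := by
    have : 0 < ρ * sin (angle a b f g s) := by
      norm_num at hw
      linarith
    exact pos_of_mul_pos_right this hρ.le
  have h6 : 0 ≤ angle a b f g s := by
    by_contra! hcon
    exact absurd (sin_neg_of_neg_of_neg_pi_lt hcon hθ) (not_lt.2 h5.le)
  exact T.lt_angle_of_sin_eq_zero hs0 hst hH sin_zero h6

end Traj

lemma exists_tendsto_of_monotone_tail {φ : ℝ → ℝ} {R B : ℝ}
    (hmon : ∀ s t, R ≤ s → s ≤ t → φ s ≤ φ t) (hB : ∀ r, R ≤ r → φ r ≤ B) :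
    ∃ l, Tendsto φ atTop (𝓝 l) := by
  have hm : Monotone fun r => φ (max R r) := fun s t hst =>
    hmon _ _ (le_max_left _ _) (max_le_max le_rfl hst)
  refine ⟨_, (tendsto_atTop_ciSup hm ⟨B, ?_⟩).congr' ?_⟩
  · rintro _ ⟨r, rfl⟩
    exact hB _ (le_max_left _ _)
  · filter_upwards [eventually_ge_atTop R] with r hr
    rw [max_eq_right hr]

lemma deriv_limit_eq_zero {φ φ' : ℝ → ℝ} {R l m : ℝ}
    (hd : ∀ r, R ≤ r → HasDerivAt φ (φ' r) r) (hφ : Tendsto φ atTop (𝓝 l))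
    (hφ' : Tendsto φ' atTop (𝓝 m)) : m = 0 := by
  have hex : ∀ r, R ≤ r → ∃ ξ, r < ξ ∧ φ' ξ = φ (r + 1) - φ r := by
    intro r hr
    obtain ⟨ξ, hξ, h⟩ := exists_hasDerivAt_eq_slope φ φ' (lt_add_one r)
      (fun s hs => (hd s (hr.trans hs.1)).continuousAt.continuousWithinAt)
      (fun s hs => hd s (hr.trans hs.1.le))
    exact ⟨ξ, hξ.1, by simpa using h⟩
  choose! ξ hξ using hex
  have h1 : Tendsto ξ atTop atTop := by
    refine tendsto_atTop_mono' _ ?_ tendsto_id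
    filter_upwards [eventually_ge_atTop R] with r hr
    exact (hξ r hr).1.le
  have h2 : Tendsto (fun r => φ (r + 1) - φ r) atTop (𝓝 (l - l)) :=
    (hφ.comp (tendsto_atTop_add_const_right _ 1 tendsto_id)).sub hφ
  rw [sub_self] at h2
  refine tendsto_nhds_unique (hφ'.comp h1) (h2.congr' ?_)
  filter_upwards [eventually_ge_atTop R] with r hr
  exact (hξ r hr).2.symm

/-- The restriction of a trajectory of non-negative energy to `[R, ∞)`, up to a global sign. -/
structure Tail (a b R : ℝ) (f g : ℝ → ℝ) : Prop where
  hb : 0 < b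
  hab : 2 * b < a
  hR : 0 < R
  df : ∀ r, R ≤ r → HasDerivAt f (g r * ((f r) ^ 2 - a * (g r) ^ 2 + b) - 2 / r * f r) r
  dg : ∀ r, R ≤ r → HasDerivAt g (f r * (1 - (g r) ^ 2)) r
  gap : ∃ δ > 0, ∀ r, R ≤ r → δ ≤ 1 - g r ^ 2
  hH : ∀ r, R ≤ r → 0 ≤ Ham a b (f r) (g r)
  Ham_le : ∀ s t, R ≤ s → s ≤ t → Ham a b (f t) (g t) ≤ Ham a b (f s) (g s)

lemma Traj.tail {a b x R σ : ℝ} {f g : ℝ → ℝ} (T : Traj a b x f g) (hR : 0 < R)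
    (hσ : σ ^ 2 = 1) (hH : ∀ r, 0 ≤ r → 0 ≤ Ham a b (f r) (g r)) :
    Tail a b R (fun r => σ * f r) fun r => σ * g r := by
  have hHam : ∀ r, Ham a b (σ * f r) (σ * g r) = Ham a b (f r) (g r) := fun r => by
    have h4 : σ ^ 4 = 1 := by
      calc σ ^ 4 = (σ ^ 2) ^ 2 := by ring
        _ = 1 := by rw [hσ, one_pow]
    unfold Ham
    rw [mul_pow, mul_pow, mul_pow, hσ, h4]
    ring
  obtain ⟨δ, hδ, hgap⟩ := T.exists_gap
  refine ⟨T.hb, T.hab, hR, fun r hr => ?_, fun r hr => ?_, ⟨δ, hδ, fun r hr => ?_⟩,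
    fun r hr => ?_, fun s t hs hst => ?_⟩
  · refine ((T.df r (hR.trans_le hr)).const_mul σ).congr_deriv ?_
    simp only [mul_pow, hσ]
    ring
  · refine ((T.dg r (hR.trans_le hr)).const_mul σ).congr_deriv ?_
    simp only [mul_pow, hσ]
    ring
  · simp only [mul_pow, hσ, one_mul]
    exact hgap r (hR.le.trans hr)
  · rw [hHam]
    exact hH r (hR.le.trans hr)
  · rw [hHam, hHam]
    exact T.Ham_le (hR.le.trans hs) hst

namespace Tail

variable {a b R : ℝ} {f g : ℝ → ℝ}

lemma g_lt_one (T : Tail a b R f g) {r : ℝ} (hr : R ≤ r) : g r ^ 2 < 1 := by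
  obtain ⟨δ, hδ, hgap⟩ := T.gap
  linarith [hgap r hr]

lemma g_mono (T : Tail a b R f g) (hf : ∀ r, R ≤ r → 0 < f r) (s t : ℝ) (hs : R ≤ s)
    (hst : s ≤ t) : g s ≤ g t := by
  refine le_of_hasDerivAt_nonneg hst
    (fun r hr => (T.dg r (hs.trans hr.1)).continuousAt.continuousWithinAt)
    (fun r hr => T.dg r (hs.trans hr.1.le)) fun r hr => ?_
  have := T.g_lt_one (hs.trans hr.1.le)
  have := hf r (hs.trans hr.1.le)
  exact mul_nonneg this.le (by linarith)

lemma g_anti (T : Tail a b R f g) (hf : ∀ r, R ≤ r → f r < 0) (s t : ℝ) (hs : R ≤ s)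
    (hst : s ≤ t) : g t ≤ g s := by
  refine neg_le_neg_iff.1 (le_of_hasDerivAt_nonneg (φ := fun r => -g r) hst
    (fun r hr => (T.dg r (hs.trans hr.1)).neg.continuousAt.continuousWithinAt)
    (fun r hr => (T.dg r (hs.trans hr.1.le)).neg) fun r hr => ?_)
  have := T.g_lt_one (hs.trans hr.1.le)
  have := hf r (hs.trans hr.1.le)
  nlinarith

theorem tendsto_zero (T : Tail a b R f g)
    (hf : (∀ r, R ≤ r → 0 < f r) ∨ ∀ r, R ≤ r → f r < 0) :
    Tendsto f atTop (𝓝 0) ∧ Tendsto g atTop (𝓝 0) := by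
  have hb := T.hb
  have hab := T.hab
  have hg1 : ∀ r, R ≤ r → |g r| ≤ 1 := fun r hr =>
    abs_le_of_sq_le_sq (by linarith [T.g_lt_one hr]) zero_le_one
  obtain ⟨l, hl⟩ : ∃ l, Tendsto g atTop (𝓝 l) := by
    rcases hf with hf | hf
    · exact exists_tendsto_of_monotone_tail (T.g_mono hf) fun r hr => (abs_le.1 (hg1 r hr)).2
    · obtain ⟨l, hl⟩ := exists_tendsto_of_monotone_tail (φ := fun r => -g r) (B := 1)
        (fun s t hs hst => neg_le_neg (T.g_anti hf s t hs hst))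
        fun r hr => by linarith [(abs_le.1 (hg1 r hr)).1]
      exact ⟨-l, by simpa using hl.neg⟩
  obtain ⟨H, hHl⟩ : ∃ H, Tendsto (fun r => Ham a b (f r) (g r)) atTop (𝓝 H) := by
    obtain ⟨H, hHl⟩ := exists_tendsto_of_monotone_tail (φ := fun r => -Ham a b (f r) (g r))
      (B := 0) (fun s t hs hst => neg_le_neg (T.Ham_le s t hs hst))
      fun r hr => by linarith [T.hH r hr]
    exact ⟨-H, by simpa using hHl.neg⟩
  have hH0 : 0 ≤ H := ge_of_tendsto hHl (by
    filter_upwards [eventually_ge_atTop R] with r hr using T.hH r hr)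
  obtain ⟨δ, hδ, hgap⟩ := T.gap
  have hl1 : 0 < 1 - l ^ 2 := hδ.trans_le (ge_of_tendsto ((hl.pow 2).const_sub 1) (by
    filter_upwards [eventually_ge_atTop R] with r hr using hgap r hr))
  have hf2 : Tendsto (fun r => f r ^ 2) atTop
      (𝓝 (2 * (H - a / 4 * l ^ 4 + b / 2 * l ^ 2) / (1 - l ^ 2))) := by
    refine Tendsto.congr' ?_ ((((hHl.sub ((hl.pow 4).const_mul (a / 4))).add
      ((hl.pow 2).const_mul (b / 2))).const_mul 2).div ((hl.pow 2).const_sub 1) hl1.ne')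
    filter_upwards [eventually_ge_atTop R] with r hr
    have : 1 - g r ^ 2 ≠ 0 := by linarith [hgap r hr]
    simp only [Pi.div_apply]
    unfold Ham
    field_simp
    ring
  obtain ⟨p, hp⟩ : ∃ p, Tendsto f atTop (𝓝 p) := by
    have hs := hf2.sqrt
    rcases hf with hf | hf
    · refine ⟨_, hs.congr' ?_⟩
      filter_upwards [eventually_ge_atTop R] with r hr
      exact sqrt_sq (hf r hr).le
    · refine ⟨_, hs.neg.congr' ?_⟩
      filter_upwards [eventually_ge_atTop R] with r hr
      rw [sqrt_sq_eq_abs, abs_of_neg (hf r hr), neg_neg]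
  have hp0 : p = 0 := by
    have := deriv_limit_eq_zero T.dg hl (hp.mul ((hl.pow 2).const_sub 1))
    exact (mul_eq_zero.1 this).resolve_right hl1.ne'
  subst hp0
  refine ⟨hp, ?_⟩
  have hrec : Tendsto (fun r : ℝ => 2 / r) atTop (𝓝 0) := tendsto_const_nhds.div_atTop tendsto_id
  have h2 := deriv_limit_eq_zero T.df hp
    ((hl.mul (((hp.pow 2).sub ((hl.pow 2).const_mul a)).add_const b)).sub (hrec.mul hp))
  have h3 : l * (b - a * l ^ 2) = 0 := by linear_combination h2
  rcases mul_eq_zero.1 h3 with h | h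
  · exact h ▸ hl
  · exfalso
    have hHlim : Tendsto (fun r => Ham a b (f r) (g r)) atTop (𝓝 (Ham a b 0 l)) := by
      unfold Ham
      exact ((((hp.pow 2).const_mul (1 / 2)).mul ((hl.pow 2).const_sub 1)).add
        ((hl.pow 4).const_mul (a / 4))).sub ((hl.pow 2).const_mul (b / 2))
    have h4 := tendsto_nhds_unique hHl hHlim
    have h5 : Ham a b 0 l = -(b / 4) * l ^ 2 := by
      unfold Ham
      linear_combination -(l ^ 2 / 4) * h
    have h6 : 0 < l ^ 2 := by
      by_contra! hcon
      nlinarith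
    nlinarith

lemma not_pos_pos (T : Tail a b R f g) (hf : ∀ r, R ≤ r → 0 < f r) (hg : 0 < g R) : False := by
  have h := (T.tendsto_zero (Or.inl hf)).2
  have := ge_of_tendsto h (by
    filter_upwards [eventually_ge_atTop R] with r hr using T.g_mono hf R r le_rfl hr)
  linarith

theorem exp_decay (T : Tail a b R f g) (hf : ∀ r, R ≤ r → f r < 0)
    (hg : ∀ r, R ≤ r → 0 < g r) :
    ∃ C > 0, ∃ K > 0, ∃ R', R ≤ R' ∧ ∀ r, R' ≤ r → |f r| + |g r| ≤ C * exp (-K * r) := by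
  have hb := T.hb
  have hab := T.hab
  have ha : 0 < a := by linarith
  obtain ⟨-, hgl⟩ := T.tendsto_zero (Or.inr hf)
  have hev : ∀ᶠ r in atTop, g r ^ 2 < min (b / a) (1 / 2) := by
    have h := hgl.pow 2
    refine h.eventually_lt_const ?_
    rw [zero_pow two_ne_zero]
    positivity
  obtain ⟨R₀, hR₀⟩ := eventually_atTop.1 hev
  set R₁ := max R R₀ with hR₁
  have hsm : ∀ r, R₁ ≤ r → a * g r ^ 2 ≤ b ∧ g r ^ 2 ≤ 1 / 2 := by
    intro r hr
    have h := hR₀ r ((le_max_right _ _).trans hr)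
    refine ⟨?_, (h.trans_le (min_le_right _ _)).le⟩
    have := (h.trans_le (min_le_left _ _)).le
    rw [le_div_iff₀ ha] at this
    linarith
  have hRR : ∀ r, R₁ ≤ r → R ≤ r := fun r hr => (le_max_left _ _).trans hr
  set c := √(b / 2) with hc
  have hc0 : 0 < c := by positivity
  have hcsq : c ^ 2 = b / 2 := sq_sqrt (by positivity)
  have hfg : ∀ r, R₁ ≤ r → c * g r ≤ -f r := by
    intro r hr
    have h1 := T.hH r (hRR r hr)
    have h2 := hsm r hr
    have h3 := hg r (hRR r hr)
    have h4 := hf r (hRR r hr)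
    refine le_of_sq_le_sq ?_ (by linarith)
    unfold Ham at h1
    rw [mul_pow, hcsq, neg_sq]
    nlinarith [sq_nonneg (f r), sq_nonneg (g r), mul_nonneg (sq_nonneg (f r)) (sq_nonneg (g r)),
      mul_nonneg (sq_nonneg (g r)) (sub_nonneg.2 h2.1)]
  have hgexp : ∀ r, R₁ ≤ r → g r ≤ g R₁ * exp (c / 2 * R₁) * exp (-(c / 2) * r) := by
    intro r hr
    have h := le_of_hasDerivAt_nonneg (φ := fun r => -(g r * exp (c / 2 * r))) hr
      (fun s hs => ((T.dg s (hRR s hs.1)).mul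
        (((hasDerivAt_id s).const_mul (c / 2)).exp)).neg.continuousAt.continuousWithinAt)
      (fun s hs => ((T.dg s (hRR s hs.1.le)).mul
        (((hasDerivAt_id s).const_mul (c / 2)).exp)).neg)
      (fun s hs => by
        have h1 := hfg s hs.1.le
        have h2 := (hsm s hs.1.le).2
        have h3 := hf s (hRR s hs.1.le)
        have h4 : 0 ≤ exp (c / 2 * s) * (-f s * (1 - g s ^ 2) - c / 2 * g s) := by
          refine mul_nonneg (exp_pos _).le ?_
          nlinarith
        simp only [id]
        linarith)
    have h5 : g r * exp (c / 2 * r) ≤ g R₁ * exp (c / 2 * R₁) := neg_le_neg_iff.1 h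
    calc g r = g r * exp (c / 2 * r) * exp (-(c / 2) * r) := by
          rw [mul_assoc, ← exp_add]
          simp
      _ ≤ _ := by gcongr
  have hfmono : ∀ s t, R₁ ≤ s → s ≤ t → f s ≤ f t := by
    intro s t hs hst
    refine le_of_hasDerivAt_nonneg hst
      (fun r hr => (T.df r (hRR r (hs.trans hr.1))).continuousAt.continuousWithinAt)
      (fun r hr => T.df r (hRR r (hs.trans hr.1.le))) fun r hr => ?_
    have hr1 := hs.trans hr.1.le
    have h1 := hg r (hRR r hr1)
    have h2 := hf r (hRR r hr1)
    have h3 := (hsm r hr1).1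
    have h4 : 0 < r := T.hR.trans_le (hRR r hr1)
    have h5 : 0 ≤ g r * ((f r) ^ 2 - a * (g r) ^ 2 + b) :=
      mul_nonneg h1.le (by nlinarith [sq_nonneg (f r)])
    have h6 : 0 ≤ 2 / r * -f r := mul_nonneg (by positivity) (by linarith)
    linarith
  have hfexp : ∀ r, R₁ + 1 ≤ r → -f r ≤ 2 * g (r - 1) := by
    intro r hr
    obtain ⟨ξ, hξ, h⟩ := exists_hasDerivAt_eq_slope g _ (by linarith : r - 1 < r)
      (fun s hs => (T.dg s (hRR s (by linarith [hs.1]))).continuousAt.continuousWithinAt)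
      (fun s hs => T.dg s (hRR s (by linarith [hs.1])))
    have h1 := hfmono ξ r (by linarith [hξ.1]) hξ.2.le
    have h2 := (hsm ξ (by linarith [hξ.1])).2
    have h3 := hf ξ (hRR ξ (by linarith [hξ.1]))
    have h4 := hg r (hRR r (by linarith))
    rw [sub_sub_cancel, div_one] at h
    nlinarith
  set A := g R₁ * exp (c / 2 * R₁) with hA
  have hA0 : 0 < A := mul_pos (hg R₁ (hRR R₁ le_rfl)) (exp_pos _)
  refine ⟨A * (2 * exp (c / 2) + 1), by positivity, c / 2, by positivity, R₁ + 1,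
    (hRR R₁ le_rfl).trans (by linarith), fun r hr => ?_⟩
  rw [abs_of_neg (hf r (hRR r (by linarith))), abs_of_pos (hg r (hRR r (by linarith)))]
  have h1 := hfexp r hr
  have h2 := hgexp r (by linarith)
  have h3 := hgexp (r - 1) (by linarith)
  have h4 : exp (-(c / 2) * (r - 1)) = exp (c / 2) * exp (-(c / 2) * r) := by
    rw [← exp_add]
    ring_nf
  rw [h4] at h3
  linarith

end Tail

namespace Traj

variable {a b x : ℝ} {f g : ℝ → ℝ}

lemma lt_angle_of_nat_mul (T : Traj a b x f g) (m : ℕ) {s t : ℝ} (hs : 0 < s) (hst : s < t)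
    (hH : 0 ≤ Ham a b (f t) (g t)) (h : m * (π / 2) ≤ angle a b f g s) :
    m * (π / 2) < angle a b f g t := by
  rcases Nat.even_or_odd' m with ⟨j, rfl | rfl⟩
  · refine T.lt_angle_of_sin_eq_zero hs hst hH ?_ h
    rw [← sin_nat_mul_pi j]
    congr 1
    push_cast
    ring
  · refine T.lt_angle_of_cos_eq_zero hs.le hst ?_ h
    have : ((2 * j + 1 : ℕ) : ℝ) * (π / 2) = π / 2 + j * π := by
      push_cast
      ring
    rw [this, cos_add_nat_mul_pi, cos_pi_div_two, mul_zero]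

/-- The signs of `f` and `g` in terms of the angle measured from `jπ`. -/
lemma polar_shift (T : Traj a b x f g) (j : ℕ) {r : ℝ} (hr : 0 < r) :
    ∃ ρ > 0, ∃ ρ' > 0, (-1) ^ j * f r = -(ρ' * sin (angle a b f g r - j * π)) ∧
      (-1) ^ j * g r = ρ * cos (angle a b f g r - j * π) := by
  obtain ⟨ρ, hρ, ρ', hρ', h1, h2⟩ := T.polar hr
  refine ⟨ρ, hρ, ρ', hρ', ?_, ?_⟩
  · rw [h1, sin_sub_nat_mul_pi]
    ring
  · rw [h2, cos_sub_nat_mul_pi]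
    ring

theorem asymptotics (T : Traj a b x f g) (hH : ∀ r, 0 ≤ r → 0 ≤ Ham a b (f r) (g r)) {B : ℝ}
    (hB : ∀ r, 0 < r → angle a b f g r ≤ B) :
    ∃ j : ℕ, (∃ R > 0, ∀ r, R ≤ r →
        j * π < angle a b f g r ∧ angle a b f g r < j * π + π / 2) ∧
      Tendsto f atTop (𝓝 0) ∧ Tendsto g atTop (𝓝 0) ∧
      ∃ C > 0, ∃ K > 0, ∀ r, 0 ≤ r → |f r| + |g r| ≤ C * exp (-K * r) := by
  classical
  have hex : ∃ m : ℕ, ∀ r, 0 < r → angle a b f g r < (m + 1) * (π / 2) := by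
    obtain ⟨m, hm⟩ := exists_nat_gt (B / (π / 2))
    rw [div_lt_iff₀ pi_div_two_pos] at hm
    refine ⟨m, fun r hr => (hB r hr).trans_lt ?_⟩
    linarith [pi_div_two_pos]
  obtain ⟨m, hm, r₀, hr₀, hmr⟩ : ∃ m : ℕ, (∀ r, 0 < r → angle a b f g r < (m + 1) * (π / 2)) ∧
      ∃ r₀ > 0, m * (π / 2) ≤ angle a b f g r₀ := by
    refine ⟨Nat.find hex, Nat.find_spec hex, ?_⟩
    rcases hcase : Nat.find hex with _ | n
    · exact ⟨1, one_pos, by simpa using (T.angle_pos one_pos (hH 1 zero_le_one)).le⟩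
    · have := Nat.find_min hex (m := n) (by omega)
      push Not at this
      obtain ⟨r, hr, h⟩ := this
      exact ⟨r, hr, by push_cast; exact h⟩
  have hlow : ∀ r, r₀ + 1 ≤ r → m * (π / 2) < angle a b f g r := fun r hr =>
    T.lt_angle_of_nat_mul m hr₀ (by linarith) (hH r (by linarith)) hmr
  have hR : 0 < r₀ + 1 := by linarith
  have hσ : ∀ j : ℕ, ((-1 : ℝ) ^ j) ^ 2 = 1 := fun j => by
    rw [← pow_mul, mul_comm, pow_mul, neg_one_sq, one_pow]
  rcases Nat.even_or_odd' m with ⟨j, rfl | rfl⟩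
  · have hint : ∀ r, r₀ + 1 ≤ r →
        j * π < angle a b f g r ∧ angle a b f g r < j * π + π / 2 := by
      intro r hr
      have h1 := hlow r hr
      have h2 := hm r (by linarith)
      push_cast at h1 h2
      constructor <;> linarith
    have tail := T.tail hR (hσ j) hH
    have hs : ∀ r, r₀ + 1 ≤ r → (-1) ^ j * f r < 0 ∧ 0 < (-1) ^ j * g r := by
      intro r hr
      obtain ⟨ρ, hρ, ρ', hρ', h1, h2⟩ := T.polar_shift j (r := r) (by linarith)
      obtain ⟨h3, h4⟩ := hint r hr
      rw [h1, h2]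
      have := sin_pos_of_pos_of_lt_pi (x := angle a b f g r - j * π) (by linarith)
        (by linarith [pi_pos])
      have := cos_pos_of_mem_Ioo (x := angle a b f g r - j * π)
        ⟨by linarith [pi_pos], by linarith⟩
      constructor
      · exact neg_neg_of_pos (by positivity)
      · positivity
    obtain ⟨htf, htg⟩ := tail.tendsto_zero (Or.inr fun r hr => (hs r hr).1)
    obtain ⟨C, hC, K, hK, R', hR', hdec⟩ := tail.exp_decay (fun r hr => (hs r hr).1)
      fun r hr => (hs r hr).2
    have hback : ∀ y : ℝ, (-1) ^ j * ((-1) ^ j * y) = y := fun y => by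
      rw [← mul_assoc, ← sq, hσ, one_mul]
    refine ⟨j, ⟨r₀ + 1, hR, hint⟩, ?_, ?_, C + (√(a - b) + 1) * exp (K * R'), by positivity, K,
      hK, fun r hr => ?_⟩
    · have := htf.const_mul ((-1 : ℝ) ^ j)
      rw [mul_zero] at this
      exact this.congr fun r => hback (f r)
    · have := htg.const_mul ((-1 : ℝ) ^ j)
      rw [mul_zero] at this
      exact this.congr fun r => hback (g r)
    · rcases le_or_gt R' r with h | h
      · have := hdec r h
        rw [abs_mul, abs_mul, abs_pow, abs_neg, abs_one, one_pow, one_mul, one_mul] at this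
        refine this.trans ?_
        gcongr
        have : 0 ≤ (√(a - b) + 1) * exp (K * R') := by positivity
        linarith
      · have h1 := T.abs_f_le hr
        have h2 := T.abs_g_le hr
        have h3 : 1 ≤ exp (K * R') * exp (-K * r) := by
          rw [← exp_add]
          exact one_le_exp (by nlinarith)
        have h4 : 0 ≤ C * exp (-K * r) := by positivity
        have h5 : 0 ≤ √(a - b) + 1 := by positivity
        nlinarith
  · exfalso
    have tail := T.tail hR (σ := -(-1) ^ j) (by rw [neg_sq, hσ]) hH
    have hs : ∀ r, r₀ + 1 ≤ r → 0 < -(-1) ^ j * f r ∧ 0 < -(-1) ^ j * g r := by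
      intro r hr
      obtain ⟨ρ, hρ, ρ', hρ', h1, h2⟩ := T.polar_shift j (r := r) (by linarith)
      have h3 := hlow r hr
      have h4 := hm r (by linarith)
      push_cast at h3 h4
      rw [neg_mul, neg_mul, h1, h2, neg_neg]
      have := sin_pos_of_pos_of_lt_pi (x := angle a b f g r - j * π) (by linarith [pi_pos])
        (by linarith)
      have := cos_neg_of_pi_div_two_lt_of_lt (x := angle a b f g r - j * π) (by linarith)
        (by linarith)
      constructor
      · positivity
      · nlinarith
    exact tail.not_pos_pos (fun r hr => (hs r hr).1) (hs _ le_rfl).2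

end Traj

lemma ncard_of_upcrossing {θ : ℝ → ℝ} (hθ : Continuous θ) (h0 : θ 0 = 0) {c : ℕ → ℝ}
    (hc : StrictMono c) (hc0 : ∀ i, 0 < c i) {j : ℕ} {R : ℝ} (hR : 0 < R)
    (hcR : ∀ i < j, c i < θ R)
    (hcross : ∀ i s t, 0 < s → s < t → c i ≤ θ s → c i < θ t) {Z : Set ℝ}
    (hZ : ∀ r, r ∈ Z ↔ 0 < r ∧ ∃ i < j, θ r = c i) : Z.Finite ∧ Z.ncard = j := by
  have hex : ∀ i, i < j → ∃ r, 0 < r ∧ θ r = c i := by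
    intro i hi
    obtain ⟨r, hr, h⟩ := intermediate_value_Icc hR.le hθ.continuousOn
      (⟨by rw [h0]; exact (hc0 i).le, (hcR i hi).le⟩ : c i ∈ Icc (θ 0) (θ R))
    refine ⟨r, lt_of_le_of_ne hr.1 ?_, h⟩
    rintro rfl
    exact (hc0 i).ne (h0 ▸ h)
  choose! τ hτ0 hτ using hex
  have himg : Z = τ '' (Finset.range j : Set ℕ) := by
    ext r
    rw [hZ]
    constructor
    · rintro ⟨hr, i, hi, h⟩
      refine ⟨i, by simpa using hi, ?_⟩
      have h1 := hτ i hi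
      have h2 := hτ0 i hi
      rcases lt_trichotomy (τ i) r with h3 | h3 | h3
      · exact absurd h (hcross i _ _ h2 h3 h1.ge).ne'
      · exact h3
      · exact absurd h1 (hcross i _ _ hr h3 h.ge).ne'
    · rintro ⟨i, hi, rfl⟩
      have hi : i < j := by simpa using hi
      exact ⟨hτ0 i hi, i, hi, hτ i hi⟩
  have hinj : InjOn τ (Finset.range j : Set ℕ) := by
    intro i hi i' hi' h
    have hi : i < j := by simpa using hi
    have hi' : i' < j := by simpa using hi'
    exact hc.injective (by rw [← hτ i hi, ← hτ i' hi', h])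
  refine ⟨himg ▸ (Finset.finite_toSet _).image _, ?_⟩
  rw [himg, hinj.ncard_image, ncard_coe_finset, Finset.card_range]

namespace Traj

variable {a b x : ℝ} {f g : ℝ → ℝ}

theorem zero_counts (T : Traj a b x f g) (hH : ∀ r, 0 ≤ r → 0 ≤ Ham a b (f r) (g r)) {j : ℕ}
    {R : ℝ} (hR : 0 < R)
    (hj : ∀ r, R ≤ r → j * π < angle a b f g r ∧ angle a b f g r < j * π + π / 2) :
    ({r | r ∈ Ioi (0 : ℝ) ∧ f r = 0}.Finite ∧ {r | r ∈ Ioi (0 : ℝ) ∧ f r = 0}.ncard = j) ∧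
      {r | r ∈ Ioi (0 : ℝ) ∧ g r = 0}.Finite ∧ {r | r ∈ Ioi (0 : ℝ) ∧ g r = 0}.ncard = j := by
  have hpi := pi_pos
  have hcos : ∀ i : ℕ, cos (π / 2 + i * π) = 0 := fun i => by
    rw [cos_add_nat_mul_pi, cos_pi_div_two, mul_zero]
  have hpos : ∀ r, 0 < r → 0 < angle a b f g r := fun r hr => T.angle_pos hr (hH r hr.le)
  have hlt : ∀ r, 0 < r → angle a b f g r < j * π + π / 2 := by
    intro r hr
    by_contra! hcon
    have h1 := T.lt_angle_of_cos_eq_zero hr.le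
      (lt_of_le_of_lt (le_max_left r R) (lt_add_one _)) (hcos j) (by linarith)
    linarith [(hj (max r R + 1) (by linarith [le_max_right r R])).2]
  constructor
  · refine ncard_of_upcrossing (c := fun i => (i + 1 : ℕ) * π) T.continuous_angle angle_zero
      (fun i i' h => ?_) (fun i => by positivity) hR (fun i hi => ?_)
      (fun i s t hs hst h => T.lt_angle_of_sin_eq_zero hs hst (hH t (hs.trans hst).le)
        (sin_nat_mul_pi _) h) fun r => ?_
    · have : ((i + 1 : ℕ) : ℝ) < (i' + 1 : ℕ) := by exact_mod_cast Nat.succ_lt_succ h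
      exact mul_lt_mul_of_pos_right this hpi
    · refine lt_of_le_of_lt ?_ (hj R le_rfl).1
      have : ((i + 1 : ℕ) : ℝ) ≤ j := by exact_mod_cast hi
      exact mul_le_mul_of_nonneg_right this hpi.le
    · simp only [mem_ofPred_eq, mem_Ioi, and_congr_right_iff]
      intro hr
      rw [T.f_eq_zero_iff hr]
      constructor
      · intro h
        obtain ⟨z, hz⟩ := sin_eq_zero_iff.1 h
        have h1 := hpos r hr
        have h2 := hlt r hr
        rw [← hz] at h1 h2
        have h3 : 0 < z := by
          have : (0 : ℝ) < z := by nlinarith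
          exact_mod_cast this
        have h4 : z < j + 1 := by
          have : (z : ℝ) < j + 1 := by nlinarith
          exact_mod_cast this
        obtain ⟨n, rfl⟩ := Int.eq_ofNat_of_zero_le h3.le
        obtain ⟨i, rfl⟩ := Nat.exists_eq_succ_of_ne_zero (by omega : n ≠ 0)
        exact ⟨i, by omega, by rw [← hz]; push_cast; ring⟩
      · rintro ⟨i, -, h⟩
        rw [h, sin_nat_mul_pi]
  · refine ncard_of_upcrossing (c := fun i => π / 2 + (i : ℕ) * π) T.continuous_angle angle_zero
      (fun i i' h => ?_) (fun i => by positivity) hR (fun i hi => ?_)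
      (fun i s t hs hst h => T.lt_angle_of_cos_eq_zero hs.le hst (hcos i) h) fun r => ?_
    · have : (i : ℝ) < i' := by exact_mod_cast h
      have := mul_lt_mul_of_pos_right this hpi
      simpa using this
    · have : (i : ℝ) + 1 ≤ j := by exact_mod_cast hi
      have := mul_le_mul_of_nonneg_right this hpi.le
      linarith [(hj R le_rfl).1]
    · simp only [mem_ofPred_eq, mem_Ioi, and_congr_right_iff]
      intro hr
      rw [T.g_eq_zero_iff hr.le]
      constructor
      · intro h
        obtain ⟨z, hz⟩ := cos_eq_zero_iff.1 h
        have h1 := hpos r hr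
        have h2 := hlt r hr
        rw [hz] at h1 h2
        have h3 : -1 < z := by
          have : (-1 : ℝ) < z := by nlinarith
          exact_mod_cast this
        have h4 : z < j := by
          have : (z : ℝ) < j := by nlinarith
          exact_mod_cast this
        obtain ⟨i, rfl⟩ := Int.eq_ofNat_of_zero_le (by omega : 0 ≤ z)
        exact ⟨i, by omega, by rw [hz]; push_cast; ring⟩
      · rintro ⟨i, -, h⟩
        rw [h, hcos]

end Traj

namespace Traj

variable {a b x : ℝ} {f g : ℝ → ℝ}

lemma hasDerivAt_mul_Ham (T : Traj a b x f g) {r : ℝ} (hr : 0 < r) :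
    HasDerivAt (fun r => r * Ham a b (f r) (g r))
      (-(3 / 2) * (f r ^ 2 * (1 - g r ^ 2)) + g r ^ 2 * (a * g r ^ 2 - 2 * b) / 4) r := by
  refine ((hasDerivAt_id r).mul (hasDerivAt_Ham (T.df r hr) (T.dg r hr))).congr_deriv ?_
  simp only [id]
  unfold Ham
  field_simp
  ring

lemma mul_nonpos_of_angle (T : Traj a b x f g) {j : ℕ} {r : ℝ} (hr : 0 < r)
    (h1 : j * π ≤ angle a b f g r) (h2 : angle a b f g r ≤ j * π + π / 2) : f r * g r ≤ 0 := by
  obtain ⟨ρ, hρ, ρ', hρ', h3, h4⟩ := T.polar_shift j hr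
  have hσ : ((-1 : ℝ) ^ j) * (-1) ^ j = 1 := by rw [← mul_pow]; simp
  have h5 := sin_nonneg_of_nonneg_of_le_pi (x := angle a b f g r - j * π) (by linarith)
    (by linarith [pi_pos])
  have h6 := cos_nonneg_of_neg_pi_div_two_le_of_le (x := angle a b f g r - j * π)
    (by linarith [pi_pos]) (by linarith)
  have h7 : f r * g r = ((-1) ^ j * f r) * ((-1) ^ j * g r) := by
    linear_combination -(f r * g r) * hσ
  rw [h7, h3, h4]
  have := mul_nonneg (mul_nonneg hρ'.le h5) (mul_nonneg hρ.le h6)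
  linarith

lemma mul_nonneg_of_angle (T : Traj a b x f g) {j : ℕ} {r : ℝ} (hr : 0 < r)
    (h1 : π / 2 + j * π ≤ angle a b f g r) (h2 : angle a b f g r ≤ (j + 1 : ℕ) * π) :
    0 ≤ f r * g r := by
  push_cast at h2
  obtain ⟨ρ, hρ, ρ', hρ', h3, h4⟩ := T.polar_shift j hr
  have hσ : ((-1 : ℝ) ^ j) * (-1) ^ j = 1 := by rw [← mul_pow]; simp
  have h5 := sin_nonneg_of_nonneg_of_le_pi (x := angle a b f g r - j * π)
    (by linarith [pi_pos]) (by linarith)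
  have h6 := cos_nonpos_of_pi_div_two_le_of_le (x := angle a b f g r - j * π) (by linarith)
    (by linarith [pi_pos])
  have h7 : f r * g r = ((-1) ^ j * f r) * ((-1) ^ j * g r) := by
    linear_combination -(f r * g r) * hσ
  rw [h7, h3, h4]
  have := mul_nonneg (mul_nonneg hρ'.le h5) (mul_nonneg hρ.le (neg_nonneg.2 h6))
  linarith

lemma sq_g_le_of_mul_nonneg (T : Traj a b x f g) {s t : ℝ} (hs : 0 < s) (hst : s ≤ t)
    (h : ∀ r ∈ Icc s t, 0 ≤ f r * g r) : g s ^ 2 ≤ g t ^ 2 := by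
  refine le_of_hasDerivAt_nonneg hst (T.cg.pow 2).continuousOn
    (fun r hr => (T.dg r (hs.trans hr.1)).pow 2) fun r hr => ?_
  have h1 := h r ⟨hr.1.le, hr.2.le⟩
  have h2 := T.hg r (hs.trans hr.1).le
  have h3 := mul_nonneg h1 (by linarith : 0 ≤ 1 - g r ^ 2)
  norm_num
  linarith

lemma sq_g_le_of_mul_nonpos (T : Traj a b x f g) {s t : ℝ} (hs : 0 < s) (hst : s ≤ t)
    (h : ∀ r ∈ Icc s t, f r * g r ≤ 0) : g t ^ 2 ≤ g s ^ 2 := by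
  refine neg_le_neg_iff.1 (le_of_hasDerivAt_nonneg (φ := fun r => -g r ^ 2) hst
    (T.cg.pow 2).neg.continuousOn
    (fun r hr => ((T.dg r (hs.trans hr.1)).pow 2).neg) fun r hr => ?_)
  have h1 := h r ⟨hr.1.le, hr.2.le⟩
  have h2 := T.hg r (hs.trans hr.1).le
  have h3 := mul_nonneg (neg_nonneg.2 h1) (by linarith : 0 ≤ 1 - g r ^ 2)
  norm_num
  linarith

/-- A trajectory passing close to the origin, at a small enough scaled energy `r H`, cannot make
another half turn beyond the next one. -/
theorem angle_le_of_small_energy (T : Traj a b x f g) {j : ℕ} {R : ℝ} (hR : 0 < R)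
    (h1 : j * π < angle a b f g R) (h2 : angle a b f g R < j * π + π / 2)
    (hg : a * g R ^ 2 < 2 * b)
    (hE : R * Ham a b (f R) (g R) < 3 / 2 * (√(b / 2) / 2) * (b / a)) {r : ℝ} (hr : 0 ≤ r) :
    angle a b f g r ≤ π / 2 + (j + 1 : ℕ) * π := by
  by_contra! hcon
  have hb := T.hb
  have ha : 0 < a := by linarith [T.hab]
  have hpi := pi_pos
  have cθ := T.continuous_angle
  have hcos : ∀ i : ℕ, cos (π / 2 + i * π) = 0 := fun i => by
    rw [cos_add_nat_mul_pi, cos_pi_div_two, mul_zero]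
  have hj : ((j + 1 : ℕ) : ℝ) * π = j * π + π := by push_cast; ring
  have hRr : R < r := by
    by_contra! h
    rcases h.lt_or_eq with h | rfl
    · have := T.lt_angle_of_cos_eq_zero hr h (hcos (j + 1)) hcon.le
      linarith
    · linarith
  obtain ⟨r₂, hr₂, hθ₂⟩ := intermediate_value_Icc hRr.le cθ.continuousOn
    (⟨by linarith, hcon.le⟩ : π / 2 + (j + 1 : ℕ) * π ∈ Icc (angle a b f g R) (angle a b f g r))
  obtain ⟨rm, hrm, hθm⟩ := intermediate_value_Icc hr₂.1 cθ.continuousOn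
    (⟨by linarith, by linarith⟩ : ((j + 1 : ℕ) : ℝ) * π ∈ Icc (angle a b f g R) (angle a b f g r₂))
  obtain ⟨r₁, hr₁, hθ₁⟩ := intermediate_value_Icc hrm.1 cθ.continuousOn
    (⟨by linarith, by linarith⟩ : π / 2 + j * π ∈ Icc (angle a b f g R) (angle a b f g rm))
  have hg₂ : g r₂ = 0 := (T.g_eq_zero_iff (hR.le.trans hr₂.1)).2 (by rw [hθ₂, hcos])
  have hH : ∀ s, R ≤ s → s ≤ r₂ → 0 ≤ Ham a b (f s) (g s) := by
    intro s hs hs2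
    refine le_trans ?_ (T.Ham_le (hR.le.trans hs) hs2)
    unfold Ham
    rw [hg₂]
    nlinarith [sq_nonneg (f r₂)]
  have hm0 : 0 < rm := hR.trans_le hrm.1
  have h10 : 0 < r₁ := hR.trans_le hr₁.1
  have hdown : ∀ s ∈ Icc R r₁, f s * g s ≤ 0 := by
    intro s hs
    refine T.mul_nonpos_of_angle (j := j) (hR.trans_le hs.1) ?_ ?_
    · rcases hs.1.eq_or_lt with h | h
      · rw [← h]
        exact h1.le
      · exact (T.lt_angle_of_sin_eq_zero hR h (hH s hs.1 (hs.2.trans (hr₁.2.trans hrm.2)))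
          (sin_nat_mul_pi j) h1.le).le
    · by_contra! h
      rcases hs.2.eq_or_lt with h' | h'
      · rw [h'] at h
        linarith
      · have := T.lt_angle_of_cos_eq_zero (hR.trans_le hs.1).le h' (hcos j) (by linarith)
        linarith
  have hup : ∀ s ∈ Icc r₁ rm, 0 ≤ f s * g s := by
    intro s hs
    refine T.mul_nonneg_of_angle (j := j) (h10.trans_le hs.1) ?_ ?_
    · rcases hs.1.eq_or_lt with h | h
      · rw [← h, hθ₁]
      · exact (T.lt_angle_of_cos_eq_zero h10.le h (hcos j) hθ₁.ge).le
    · by_contra! h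
      rcases hs.2.eq_or_lt with h' | h'
      · rw [h'] at h
        linarith
      · have := T.lt_angle_of_sin_eq_zero (h10.trans_le hs.1) h' (hH rm hrm.1 hrm.2)
          (sin_nat_mul_pi (j + 1)) h.le
        linarith
  have hfm : f rm = 0 := (T.f_eq_zero_iff hm0).2 (by rw [hθm, sin_nat_mul_pi])
  have hgm := T.sq_g_ge_of_f_eq_zero hm0 hfm (hH rm hrm.1 hrm.2)
  have hg₁ : g r₁ = 0 := (T.g_eq_zero_iff h10.le).2 (by rw [hθ₁, hcos])
  have hE₁ : r₁ * Ham a b (f r₁) (g r₁) ≤ R * Ham a b (f R) (g R) := by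
    refine neg_le_neg_iff.1 (le_of_hasDerivAt_nonneg
      (φ := fun r => -(r * Ham a b (f r) (g r))) hr₁.1
      (continuous_id.mul T.continuous_Ham).neg.continuousOn
      (fun s hs => (T.hasDerivAt_mul_Ham (hR.trans hs.1)).neg) fun s hs => ?_)
    have h3 := T.sq_g_le_of_mul_nonpos hR hs.1.le
      fun t ht => hdown t ⟨ht.1, ht.2.trans hs.2.le⟩
    have h4 := T.hg s (hR.trans hs.1).le
    have h5 := mul_nonneg (sq_nonneg (f s)) (by linarith : 0 ≤ 1 - g s ^ 2)
    have h6 : 0 ≤ g s ^ 2 * (2 * b - a * g s ^ 2) :=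
      mul_nonneg (sq_nonneg _) (by nlinarith)
    linarith
  obtain ⟨re, hre, hge⟩ := intermediate_value_Icc hr₁.2 (T.cg.pow 2).continuousOn
    (⟨by rw [hg₁, zero_pow two_ne_zero]; positivity, by rw [div_le_iff₀ ha]; nlinarith⟩ :
      b / a ∈ Icc (g r₁ ^ 2) (g rm ^ 2))
  have hge : g re ^ 2 = b / a := hge
  set c := √(b / 2) / 2 with hc
  have hc0 : 0 < c := by positivity
  have hcsq : (2 * c) ^ 2 = b / 2 := by
    rw [hc, mul_div_cancel₀ _ two_ne_zero, sq_sqrt (by positivity)]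
  have hEe : re * Ham a b (f re) (g re) + 3 / 2 * c * g re ^ 2 ≤
      r₁ * Ham a b (f r₁) (g r₁) + 3 / 2 * c * g r₁ ^ 2 := by
    refine neg_le_neg_iff.1 (le_of_hasDerivAt_nonneg
      (φ := fun r => -(r * Ham a b (f r) (g r) + 3 / 2 * c * g r ^ 2)) hre.1
      ((continuous_id.mul T.continuous_Ham).add ((T.cg.pow 2).const_smul (3 / 2 * c))).neg.continuousOn
      (fun s hs => ((T.hasDerivAt_mul_Ham (h10.trans hs.1)).add
        (((T.dg s (h10.trans hs.1)).pow 2).const_mul (3 / 2 * c))).neg) fun s hs => ?_)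
    have h3 := T.sq_g_le_of_mul_nonneg (h10.trans hs.1) hs.2.le
      fun t ht => hup t ⟨hs.1.le.trans ht.1, ht.2.trans hre.2⟩
    rw [hge, le_div_iff₀ ha] at h3
    have h4 := T.hg s (h10.trans hs.1).le
    have h5 := hup s ⟨hs.1.le, hs.2.le.trans hre.2⟩
    have h6 := hH s (hr₁.1.trans hs.1.le) ((hs.2.le.trans hre.2).trans hrm.2)
    have h7 : (2 * c * g s) ^ 2 ≤ f s ^ 2 := by
      unfold Ham at h6
      rw [mul_pow, hcsq]
      nlinarith [mul_nonneg (sq_nonneg (f s)) (sq_nonneg (g s)),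
        mul_nonneg (sq_nonneg (g s)) (by linarith : 0 ≤ b - a * g s ^ 2)]
    have h8 : 2 * c * (f s * g s) ≤ f s ^ 2 := by linarith [sq_nonneg (f s - 2 * c * g s)]
    have h9 : 0 ≤ (f s ^ 2 - 2 * c * (f s * g s)) * (1 - g s ^ 2) :=
      mul_nonneg (by linarith) (by linarith)
    have h10 := mul_nonneg (sq_nonneg (g s)) (by linarith : 0 ≤ 2 * b - a * g s ^ 2)
    norm_num
    linarith
  have hHe := mul_nonneg (h10.le.trans hre.1)
    (hH re (hr₁.1.trans hre.1) (hre.2.trans hrm.2))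
  have h12 : g r₁ ^ 2 = 0 := by rw [hg₁, zero_pow two_ne_zero]
  rw [hge, h12] at hEe
  linarith

end Traj

namespace Traj

variable {a b x : ℝ} {f g : ℝ → ℝ}

lemma one_sub_sq_g_le (T : Traj a b x f g) {r : ℝ} (hr : 0 ≤ r) :
    1 - g r ^ 2 ≤ (1 - x ^ 2) * exp (2 * √(a - b) * r) := by
  set M := √(a - b) with hM
  have cf := T.cf
  have cg := T.cg
  have h := le_of_hasDerivAt_nonneg (φ := fun s => -((1 - g s ^ 2) * exp (-(2 * M) * s))) hr
    (by fun_prop)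
    (fun s hs => ((((T.dg s hs.1).pow 2).const_sub 1).mul
      (((hasDerivAt_id s).const_mul (-(2 * M))).exp)).neg)
    (fun s hs => by
      have h3 := T.hg s hs.1.le
      have h4 : 0 ≤ f s * g s + M := by
        have : |f s * g s| ≤ M * 1 := by
          rw [abs_mul]
          exact mul_le_mul (T.abs_f_le hs.1.le) (T.abs_g_le hs.1.le) (abs_nonneg _)
            (sqrt_nonneg _)
        linarith [(abs_le.1 this).1]
      have h5 : 0 ≤ 2 * (1 - g s ^ 2) * exp (-(2 * M) * s) * (f s * g s + M) :=
        mul_nonneg (mul_nonneg (by linarith) (exp_pos _).le) h4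
      refine h5.trans_eq ?_
      simp only [id, Pi.pow_apply]
      push_cast
      ring)
  simp only [T.g_zero, mul_zero, exp_zero, mul_one] at h
  have h' := neg_le_neg_iff.1 h
  calc 1 - g r ^ 2 = (1 - g r ^ 2) * exp (-(2 * M) * r) * exp (2 * M * r) := by
        rw [mul_assoc, ← exp_add]
        simp
    _ ≤ _ := by gcongr

/-- Between consecutive zeros of `f` beyond `r₁`, the energy drops by at most `4 √(a - b) / r₁`. -/
lemma Ham_loss (T : Traj a b x f g) {r₁ s t τ : ℝ} (hr₁ : 0 < r₁) (hs : r₁ ≤ s) (hst : s ≤ t)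
    (hτ : τ ^ 2 = 1) (h : ∀ r ∈ Ioo s t, 0 ≤ τ * f r) :
    Ham a b (f s) (g s) - 4 * √(a - b) / r₁ ≤ Ham a b (f t) (g t) := by
  set M := √(a - b) with hM
  have hM0 : 0 ≤ M := sqrt_nonneg _
  have hs0 : 0 < s := hr₁.trans_le hs
  have hτ1 : |τ| = 1 := by
    rw [← sq_eq_sq₀ (abs_nonneg _) zero_le_one, sq_abs, hτ, one_pow]
  have hmon := le_of_hasDerivAt_nonneg
    (φ := fun r => Ham a b (f r) (g r) + 2 * M / r₁ * (τ * g r)) hst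
    (T.continuous_Ham.add (continuous_const.mul (continuous_const.mul T.cg))).continuousOn
    (fun r hr => (hasDerivAt_Ham (T.df r (hs0.trans hr.1)) (T.dg r (hs0.trans hr.1))).add
      (((T.dg r (hs0.trans hr.1)).const_mul τ).const_mul (2 * M / r₁)))
    (fun r hr => by
      have hr0 := hs0.trans hr.1
      have h1 := T.hg r hr0.le
      have h2 := h r hr
      have h3 : τ * f r ≤ M := by
        refine (le_abs_self _).trans ?_
        rw [abs_mul, hτ1, one_mul]
        exact T.abs_f_le hr0.le
      have h4 : f r ^ 2 / r ≤ M * (τ * f r) / r₁ := by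
        have : f r ^ 2 = (τ * f r) * (τ * f r) := by
          linear_combination -(f r ^ 2) * hτ
        rw [this]
        exact div_le_div₀ (mul_nonneg hM0 h2) (mul_le_mul_of_nonneg_right h3 h2) hr₁
          (hs.trans hr.1.le)
      have h5 : 0 ≤ 2 * (1 - g r ^ 2) * (M * (τ * f r) / r₁ - f r ^ 2 / r) :=
        mul_nonneg (by linarith) (by linarith)
      refine h5.trans_eq ?_
      field_simp
      ring)
  have hb : ∀ q, 0 ≤ q → |2 * M / r₁ * (τ * g q)| ≤ 2 * M / r₁ := by
    intro q hq
    rw [abs_mul, abs_mul, hτ1, one_mul, abs_of_nonneg (by positivity)]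
    exact mul_le_of_le_one_right (by positivity) (T.abs_g_le hq)
  have h1 := (abs_le.1 (hb s hs0.le)).1
  have h2 := (abs_le.1 (hb t (hs0.le.trans hst))).2
  have h3 : 4 * M / r₁ = 2 * (2 * M / r₁) := by ring
  linarith

lemma Ham_ge_of_angle_le (T : Traj a b x f g) {r₁ h₀ : ℝ} (hr₁ : 0 < r₁)
    (hh : h₀ ≤ Ham a b (f r₁) (g r₁)) (m : ℕ) :
    ∀ r, r₁ ≤ r → 0 ≤ Ham a b (f r) (g r) → angle a b f g r ≤ m * π →
      h₀ - 4 * √(a - b) / r₁ * m ≤ Ham a b (f r) (g r) := by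
  have hL : 0 ≤ 4 * √(a - b) / r₁ := by positivity
  induction m with
  | zero =>
    intro r hr hH h
    have := T.angle_pos (hr₁.trans_le hr) hH
    simp only [Nat.cast_zero, zero_mul] at h
    linarith
  | succ m ih =>
    intro r hr hH h
    rcases le_or_gt (angle a b f g r) (m * π) with hm | hm
    · have := ih r hr hH hm
      push_cast
      linarith
    obtain ⟨s, hs, hθs, hHs⟩ : ∃ s ∈ Icc r₁ r, m * π ≤ angle a b f g s ∧
        h₀ - 4 * √(a - b) / r₁ * m ≤ Ham a b (f s) (g s) := by
      rcases le_or_gt (angle a b f g r₁) (m * π) with h1 | h1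
      · obtain ⟨s, hs, hθs⟩ := intermediate_value_Icc hr T.continuous_angle.continuousOn
          (⟨h1, hm.le⟩ : (m : ℝ) * π ∈ Icc (angle a b f g r₁) (angle a b f g r))
        exact ⟨s, hs, hθs.ge, ih s hs.1 (hH.trans (T.Ham_le (hr₁.le.trans hs.1) hs.2)) hθs.le⟩
      · refine ⟨r₁, ⟨le_rfl, hr⟩, h1.le, hh.trans' ?_⟩
        have : 0 ≤ 4 * √(a - b) / r₁ * m := by positivity
        linarith
    have hs0 := hr₁.trans_le hs.1
    have := T.Ham_loss (τ := -(-1) ^ m) hr₁ hs.1 hs.2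
      (by rw [neg_sq, ← pow_mul, mul_comm, pow_mul, neg_one_sq, one_pow]) fun q hq => by
        have hq0 := hs0.trans hq.1
        obtain ⟨-, -, ρ', hρ', h1, -⟩ := T.polar_shift m hq0
        have h2 := T.lt_angle_of_sin_eq_zero hs0 hq.1 (hH.trans (T.Ham_le hq0.le hq.2.le))
          (sin_nat_mul_pi m) hθs
        have h3 : angle a b f g q ≤ (m + 1 : ℕ) * π := by
          by_contra! hcon
          have := T.lt_angle_of_sin_eq_zero hq0 hq.2 hH (sin_nat_mul_pi (m + 1)) hcon.le
          linarith
        push_cast at h3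
        rw [neg_mul, h1, neg_neg]
        exact mul_nonneg hρ'.le (sin_nonneg_of_nonneg_of_le_pi (by linarith) (by linarith))
    push_cast
    linarith

end Traj

/-- Trajectories starting close enough to `g = 1` make arbitrarily many turns. -/
theorem exists_many_turns {a b : ℝ} (hb : 0 < b) (hab : 2 * b < a) (k : ℕ) :
    ∃ x ∈ Ioo (0 : ℝ) 1, ∀ f g, Traj a b x f g → ∃ r > 0, π / 2 + k * π < angle a b f g r := by
  have ha : 0 < a := by linarith
  set M := √(a - b) with hM
  have hM0 : 0 ≤ M := sqrt_nonneg _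
  set y := (1 + 2 * b / a) / 2 with hy
  have hy1 : y < 1 := by
    have : 2 * b / a < 1 := (div_lt_one ha).2 hab
    linarith
  have hy0 : 2 * b < a * y := by
    rw [hy]
    field_simp
    linarith
  have hypos : 0 < y := by positivity
  set h₀ := y * (a * y - 2 * b) / 4 with hh₀
  have hh0 : 0 < h₀ := by
    have : 0 < a * y - 2 * b := by linarith
    positivity
  set r₁ := 4 * M * (k + 1) / h₀ + 1 with hr₁
  have hr1 : 0 < r₁ := by positivity
  have hloss : 0 < h₀ - 4 * M / r₁ * (k + 1 : ℕ) := by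
    have : 4 * M / r₁ * (k + 1 : ℕ) < h₀ := by
      rw [div_mul_eq_mul_div, div_lt_iff₀ hr1, hr₁, mul_add, mul_div_cancel₀ _ hh0.ne']
      push_cast
      linarith
    linarith
  set η := (1 - y) * exp (-(2 * M * r₁)) with hη
  have hη0 : 0 < η := mul_pos (by linarith) (exp_pos _)
  have hη1 : η < 1 := by
    have : exp (-(2 * M * r₁)) ≤ 1 := exp_le_one_iff.2 (by
      have : 0 ≤ 2 * M * r₁ := by positivity
      linarith)
    nlinarith
  have hxsq : √(1 - η) ^ 2 = 1 - η := sq_sqrt (by linarith)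
  refine ⟨√(1 - η), ⟨sqrt_pos.2 (by linarith), ?_⟩, fun f g T => ?_⟩
  · rw [sqrt_lt' one_pos]
    linarith
  by_contra! hcon
  have hgr : y ≤ g r₁ ^ 2 := by
    have h := T.one_sub_sq_g_le hr1.le
    have h2 : exp (-(2 * M * r₁)) * exp (2 * M * r₁) = 1 := by rw [← exp_add]; simp
    rw [hxsq, sub_sub_cancel, hη, mul_assoc, h2] at h
    linarith
  have hH1 : h₀ ≤ Ham a b (f r₁) (g r₁) := by
    have h1 := T.hg r₁ hr1.le
    have h2 := mul_nonneg (sq_nonneg (f r₁)) (by linarith : 0 ≤ 1 - g r₁ ^ 2)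
    have h3 : 0 ≤ (g r₁ ^ 2 - y) * (a * (g r₁ ^ 2 + y) - 2 * b) :=
      mul_nonneg (by linarith) (by nlinarith)
    unfold Ham
    rw [hh₀]
    linarith
  have hQ : ∀ r, r₁ ≤ r → 0 ≤ Ham a b (f r) (g r) →
      h₀ - 4 * M / r₁ * (k + 1 : ℕ) ≤ Ham a b (f r) (g r) := by
    intro r hr hH
    refine T.Ham_ge_of_angle_le hr1 hH1 (k + 1) r hr hH ?_
    have := hcon r (hr1.trans_le hr)
    push_cast
    linarith [pi_pos]
  have hpos : ∀ r, r₁ ≤ r → 0 ≤ Ham a b (f r) (g r) := by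
    intro r hr
    by_contra! hneg
    obtain ⟨s, hs, h⟩ := intermediate_value_Icc' hr T.continuous_Ham.continuousOn
      (⟨hneg.le, hh0.le.trans hH1⟩ : (0 : ℝ) ∈ Icc (Ham a b (f r) (g r)) (Ham a b (f r₁) (g r₁)))
    have := hQ s hs.1 h.ge
    linarith
  obtain ⟨-, -, hf, hg, -⟩ := T.asymptotics
    (fun r hr => (hpos _ (le_max_left r₁ r)).trans (T.Ham_le hr (le_max_right r₁ r))) hcon
  have hlim : Tendsto (fun r => Ham a b (f r) (g r)) atTop (𝓝 (Ham a b 0 0)) := by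
    unfold Ham
    exact ((((hf.pow 2).const_mul (1 / 2)).mul ((hg.pow 2).const_sub 1)).add
      ((hg.pow 4).const_mul (a / 4))).sub ((hg.pow 2).const_mul (b / 2))
  have := ge_of_tendsto hlim (by
    filter_upwards [eventually_ge_atTop r₁] with r hr using hQ r hr (hpos r hr))
  have h0 : Ham a b 0 0 = 0 := by simp [Ham]
  linarith

namespace Traj

variable {a b x : ℝ} {f g : ℝ → ℝ}

lemma angle_le_of_Ham_neg (T : Traj a b x f g) {k : ℕ} {R : ℝ} (hR : 0 ≤ R)
    (hH : Ham a b (f R) (g R) < 0) (h : angle a b f g R < π / 2 + k * π) {r : ℝ} (hr : 0 ≤ r) :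
    angle a b f g r ≤ π / 2 + k * π := by
  have hcos : cos (π / 2 + k * π) = 0 := by
    rw [cos_add_nat_mul_pi, cos_pi_div_two, mul_zero]
  by_contra! hcon
  rcases lt_trichotomy r R with h1 | rfl | h1
  · exact (T.lt_angle_of_cos_eq_zero hr h1 hcos hcon.le).not_gt h
  · exact hcon.not_gt h
  · obtain ⟨s, hs, hθ⟩ := intermediate_value_Icc h1.le T.continuous_angle.continuousOn
      (⟨h.le, hcon.le⟩ : π / 2 + k * π ∈ Icc (angle a b f g R) (angle a b f g r))
    have hg : g s = 0 := (T.g_eq_zero_iff (hR.trans hs.1)).2 (by rw [hθ, hcos])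
    have h2 := T.Ham_le hR hs.1
    unfold Ham at h2 hH
    rw [hg] at h2
    nlinarith [sq_nonneg (f s)]

end Traj

lemma tendsto_mul_Ham {a b C K : ℝ} {f g : ℝ → ℝ} (hK : 0 < K) (hf : Tendsto f atTop (𝓝 0))
    (hg : Tendsto g atTop (𝓝 0)) (h : ∀ r, 0 ≤ r → |f r| + |g r| ≤ C * exp (-K * r)) :
    Tendsto (fun r => r * Ham a b (f r) (g r)) atTop (𝓝 0) := by
  have hexp : Tendsto (fun r => C * (r * exp (-K * r))) atTop (𝓝 0) := by
    have := (tendsto_rpow_mul_exp_neg_mul_atTop_nhds_zero 1 K hK).const_mul C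
    simpa only [rpow_one, mul_zero] using this
  have hrf : Tendsto (fun r => r * f r) atTop (𝓝 0) := by
    refine squeeze_zero_norm' ?_ hexp
    filter_upwards [eventually_ge_atTop 0] with r hr
    rw [norm_mul, norm_eq_abs, norm_eq_abs, abs_of_nonneg hr, mul_left_comm]
    exact mul_le_mul_of_nonneg_left (by linarith [h r hr, abs_nonneg (g r)]) hr
  have hrg : Tendsto (fun r => r * g r) atTop (𝓝 0) := by
    refine squeeze_zero_norm' ?_ hexp
    filter_upwards [eventually_ge_atTop 0] with r hr
    rw [norm_mul, norm_eq_abs, norm_eq_abs, abs_of_nonneg hr, mul_left_comm]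
    exact mul_le_mul_of_nonneg_left (by linarith [h r hr, abs_nonneg (f r)]) hr
  have h1 := (hrf.mul ((hf.const_mul (1 / 2)).mul ((hg.pow 2).const_sub 1))).add
    (hrg.mul (((hg.pow 3).const_mul (a / 4)).sub (hg.const_mul (b / 2))))
  simp only [zero_mul, add_zero] at h1
  refine h1.congr fun r => ?_
  unfold Ham
  ring

lemma continuousAt_angle {a b : ℝ} {F G : ℝ → ℝ → ℝ}
    (hT : ∀ x ∈ Ioo (0 : ℝ) 1, Traj a b x (F x) (G x))
    (hF : Continuous fun p : ℝ × ℝ => F p.1 p.2) (hG : Continuous fun p : ℝ × ℝ => G p.1 p.2)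
    (r : ℝ) {x : ℝ} (hx : x ∈ Ioo (0 : ℝ) 1) :
    ContinuousAt (fun x => angle a b (F x) (G x) r) x := by
  refine ContinuousOn.continuousAt (s := Ioo 0 1) ?_ (Ioo_mem_nhds hx.1 hx.2)
  rw [continuousOn_iff_continuous_domRestrict]
  have hF' : Continuous fun p : Ioo (0 : ℝ) 1 × ℝ => F p.1 p.2 :=
    hF.comp ((continuous_subtype_val.comp continuous_fst).prodMk continuous_snd)
  have hG' : Continuous fun p : Ioo (0 : ℝ) 1 × ℝ => G p.1 p.2 :=
    hG.comp ((continuous_subtype_val.comp continuous_fst).prodMk continuous_snd)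
  refine intervalIntegral.continuous_parametric_intervalIntegral_of_continuous'
    (f := fun (x : Ioo (0 : ℝ) 1) s => angleRate a b (F x) (G x) s) ?_ 0 r
  unfold angleRate Function.uncurry
  exact Continuous.div (by fun_prop) (by fun_prop)
    fun p => ((hT p.1 p.1.2).angle_denom_pos p.2).ne'

/-- The initial values whose trajectory turns past the angle `π / 2 + k π`. -/
def turnSet (a b : ℝ) (F G : ℝ → ℝ → ℝ) (k : ℕ) : Set ℝ :=
  {x | x ∈ Ioo (0 : ℝ) 1 ∧ ∃ r > 0, π / 2 + k * π < angle a b (F x) (G x) r}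

theorem exists_bound_state_of_boundary {a b : ℝ} {F G : ℝ → ℝ → ℝ}
    (hT : ∀ x ∈ Ioo (0 : ℝ) 1, Traj a b x (F x) (G x))
    (hF : Continuous fun p : ℝ × ℝ => F p.1 p.2) (hG : Continuous fun p : ℝ × ℝ => G p.1 p.2)
    {k : ℕ} {x : ℝ} (hx : x ∈ Ioo (0 : ℝ) 1) (hxU : x ∉ turnSet a b F G k)
    (hxc : x ∈ closure (turnSet a b F G k)) :
    (∀ r, 0 ≤ r → 0 ≤ Ham a b (F x r) (G x r)) ∧
      (∃ R > 0, ∀ r, R ≤ r → k * π < angle a b (F x) (G x) r ∧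
        angle a b (F x) (G x) r < k * π + π / 2) ∧
      ∃ C > 0, ∃ K > 0, ∀ r, 0 ≤ r → |F x r| + |G x r| ≤ C * exp (-K * r) := by
  have T := hT x hx
  have hpi := pi_pos
  have hfreq := mem_closure_iff_frequently.1 hxc
  have hIoo : ∀ᶠ y in 𝓝 x, y ∈ Ioo (0 : ℝ) 1 := Ioo_mem_nhds hx.1 hx.2
  have hle : ∀ r, 0 < r → angle a b (F x) (G x) r ≤ π / 2 + k * π := by
    intro r hr
    by_contra! hcon
    exact hxU ⟨hx, r, hr, hcon⟩
  have cF : ∀ r, Continuous fun y => F y r := fun r =>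
    hF.comp (continuous_id.prodMk continuous_const)
  have cG : ∀ r, Continuous fun y => G y r := fun r =>
    hG.comp (continuous_id.prodMk continuous_const)
  have cH : ∀ r, Continuous fun y => Ham a b (F y r) (G y r) := by
    intro r
    have := cF r
    have := cG r
    unfold Ham
    fun_prop
  have hH : ∀ r, 0 ≤ r → 0 ≤ Ham a b (F x r) (G x r) := by
    by_contra! hcon
    obtain ⟨R, hR, hneg⟩ := hcon
    have hlt : angle a b (F x) (G x) R < π / 2 + k * π := by
      rcases hR.eq_or_lt with rfl | hR'
      · rw [Traj.angle_zero]
        positivity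
      · refine (hle R hR').lt_of_ne fun h => ?_
        have hg : G x R = 0 := (T.g_eq_zero_iff hR).2 (by
          rw [h, cos_add_nat_mul_pi, cos_pi_div_two, mul_zero])
        unfold Ham at hneg
        rw [hg] at hneg
        nlinarith [sq_nonneg (F x R)]
    have h1 := (cH R).continuousAt.eventually_lt_const hneg
    have h2 := (continuousAt_angle hT hF hG R hx).eventually_lt_const hlt
    obtain ⟨y, ⟨hy, r, hr, hyr⟩, h3, h4⟩ := (hfreq.and_eventually (h1.and h2)).exists
    exact ((hT y hy).angle_le_of_Ham_neg hR h3 h4 hr.le).not_gt hyr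
  obtain ⟨j, ⟨R₀, hR₀, hj⟩, hf, hg, C, hC, K, hK, hdec⟩ := T.asymptotics hH hle
  have hjk : j ≤ k := by
    have h1 := (hj R₀ le_rfl).1
    have h2 := hle R₀ hR₀
    have : (j : ℝ) < k + 1 := by nlinarith
    have : j < k + 1 := by exact_mod_cast this
    omega
  obtain rfl : j = k := by
    by_contra hne
    have hb := T.hb
    have ha : 0 < a := by linarith [T.hab]
    have hε : 0 < 3 / 2 * (√(b / 2) / 2) * (b / a) := by positivity
    have e1 := (tendsto_mul_Ham (a := a) (b := b) hK hf hg hdec).eventually_lt_const hε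
    have e2 : ∀ᶠ r in atTop, a * G x r ^ 2 < 2 * b :=
      ((hg.pow 2).const_mul a).eventually_lt_const (by norm_num; exact hb)
    obtain ⟨R, h1, h2, hR⟩ := (e1.and (e2.and (eventually_ge_atTop R₀))).exists
    have hRpos := hR₀.trans_le hR
    have cθ := continuousAt_angle hT hF hG R hx
    have n1 := (continuous_const.mul (cH R)).continuousAt.eventually_lt_const h1
    have n2 := (continuous_const.mul ((cG R).pow 2)).continuousAt.eventually_lt_const h2
    have n3 := cθ.eventually_const_lt (hj R hR).1
    have n4 := cθ.eventually_lt_const (hj R hR).2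
    obtain ⟨y, ⟨hy, r, hr, hyr⟩, h3, h4, h5, h6⟩ :=
      (hfreq.and_eventually (n1.and (n2.and (n3.and n4)))).exists
    have h7 := (hT y hy).angle_le_of_small_energy hRpos h5 h6 h4 h3 hr.le
    have h8 : ((j + 1 : ℕ) : ℝ) ≤ k := by exact_mod_cast (by omega : j + 1 ≤ k)
    have h9 := mul_le_mul_of_nonneg_right h8 hpi.le
    linarith
  exact ⟨hH, ⟨R₀, hR₀, hj⟩, C, hC, K, hK, hdec⟩

lemma sInf_turnSet {a b : ℝ} (hb : 0 < b) (hab : 2 * b < a) {F G : ℝ → ℝ → ℝ}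
    (hT : ∀ x ∈ Ioo (0 : ℝ) 1, Traj a b x (F x) (G x))
    (hF : Continuous fun p : ℝ × ℝ => F p.1 p.2) (hG : Continuous fun p : ℝ × ℝ => G p.1 p.2)
    (k : ℕ) : BddBelow (turnSet a b F G k) ∧ (turnSet a b F G k).Nonempty ∧
      sInf (turnSet a b F G k) ∈ Ioo (0 : ℝ) 1 ∧
      sInf (turnSet a b F G k) ∉ turnSet a b F G k ∧
      sInf (turnSet a b F G k) ∈ closure (turnSet a b F G k) := by
  have ha : 0 < a := by linarith
  have hlow : ∀ x ∈ turnSet a b F G k, 2 * b / a ≤ x := by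
    rintro x ⟨hx, r, hr, h⟩
    by_contra! hcon
    rw [lt_div_iff₀ ha] at hcon
    have T := hT x hx
    refine (T.angle_le_of_Ham_neg le_rfl ?_ ?_ hr.le).not_gt h
    · rw [T.f_zero, T.g_zero]
      have hx2 : 0 < x ^ 2 := pow_pos hx.1 2
      have h1 : a * x ^ 2 < 2 * b := by nlinarith [hx.1, hx.2]
      unfold Ham
      nlinarith
    · rw [Traj.angle_zero]
      have := pi_pos
      positivity
  have hbdd : BddBelow (turnSet a b F G k) := ⟨_, hlow⟩
  obtain ⟨y, hy, hturn⟩ := exists_many_turns hb hab k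
  have hyU : y ∈ turnSet a b F G k := ⟨hy, hturn _ _ (hT y hy)⟩
  have hne : (turnSet a b F G k).Nonempty := ⟨y, hyU⟩
  have h0 : 0 < sInf (turnSet a b F G k) :=
    lt_of_lt_of_le (by positivity) (le_csInf hne hlow)
  have hmem : sInf (turnSet a b F G k) ∈ Ioo (0 : ℝ) 1 := ⟨h0, (csInf_le hbdd hyU).trans_lt hy.2⟩
  refine ⟨hbdd, hne, hmem, ?_, csInf_mem_closure hne hbdd⟩
  rintro ⟨hx, r, hr, h⟩
  have h1 := (continuousAt_angle hT hF hG r hx).eventually_const_lt h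
  have h2 := h1.and (Ioo_mem_nhds hx.1 hx.2)
  obtain ⟨z, hz, hlt⟩ := ((h2.filter_mono nhdsWithin_le_nhds).and
    (self_mem_nhdsWithin (s := Iio (sInf (turnSet a b F G k))))).exists
  exact (csInf_le hbdd ⟨hz.2, r, hr, hz.1⟩).not_gt hlt

/-- Theorem 1.1: existence of infinitely many excited states for the
original system, ordered by the number of nodes, with exponential decay. -/
theorem excited_states_exist (a b : ℝ) (hb : 0 < b) (hab : 2 * b < a) :
    ∃ x : ℕ → ℝ, StrictMono x ∧ (∀ k, x k ∈ Ioo (0 : ℝ) 1) ∧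
      ∀ k : ℕ, ∃ f g : ℝ → ℝ,
        IsSolOn a b (x k) f g (Ici 0) ∧
        {r | r ∈ Ioi (0 : ℝ) ∧ f r = 0}.Finite ∧
        {r | r ∈ Ioi (0 : ℝ) ∧ f r = 0}.ncard = k ∧
        {r | r ∈ Ioi (0 : ℝ) ∧ g r = 0}.Finite ∧
        {r | r ∈ Ioi (0 : ℝ) ∧ g r = 0}.ncard = k ∧
        ∃ C > 0, ∃ K > 0, ∀ r ≥ 0, |f r| + |g r| ≤ C * Real.exp (-K * r) := by
  obtain ⟨F, G, hT, hF, hG⟩ := exists_traj hb hab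
  have hX := sInf_turnSet hb hab hT hF hG
  have hbound := fun k => exists_bound_state_of_boundary hT hF hG (hX k).2.2.1 (hX k).2.2.2.1
    (hX k).2.2.2.2
  refine ⟨fun k => sInf (turnSet a b F G k), strictMono_nat_of_lt_succ fun k => ?_,
    fun k => (hX k).2.2.1, fun k => ?_⟩
  · refine lt_of_le_of_ne (csInf_le_csInf (hX k).1 (hX (k + 1)).2.1 ?_) fun h => ?_
    · rintro x ⟨hx, r, hr, h⟩
      refine ⟨hx, r, hr, h.trans' ?_⟩
      push_cast
      linarith [pi_pos]
    · obtain ⟨-, ⟨R, -, h1⟩, -⟩ := hbound k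
      obtain ⟨-, ⟨R', -, h2⟩, -⟩ := hbound (k + 1)
      have h3 := (h1 (max R R') (le_max_left _ _)).2
      have h4 := (h2 (max R R') (le_max_right _ _)).1
      rw [← h] at h4
      push_cast at h4
      linarith [pi_pos]
  · obtain ⟨hH, ⟨R, hR, hj⟩, hdec⟩ := hbound k
    have T := hT _ (hX k).2.2.1
    obtain ⟨⟨h1, h2⟩, h3, h4⟩ := T.zero_counts hH hR hj
    exact ⟨_, _, ⟨T.f_zero, T.g_zero, T.cf.continuousOn, T.cg.continuousOn,
      fun r _ hr => ⟨T.df r hr, T.dg r hr⟩⟩, h1, h2, h3, h4, hdec⟩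
end
end

section
/- Let a, b > 0, let η ∈ (0, √(a−b) − √(a/2)), let φ_η be an admissible cutoff, and let x ∈ ℝ. Then there exists τ_η > 0 and a unique C¹ solution (f_{x,η}, g_{x,η}) : [0, τ_η] → ℝ² of the regularized system f' + (2φ_η(f,g)/r) f = g(f² − a g² + b), g' = f(1 − g²) with f_{x,η}(0) = 0 and g_{x,η}(0) = x. Moreover this solution extends to a maximal interval [0, R_{x,η}) with either R_{x,η} = +∞, or R_{x,η} < +∞ and |f_{x,η}(r)| + |g_{x,η}(r)| → +∞ as r → R_{x,η}. -/
open Real Set Filter Topology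

noncomputable section

theorem hasDerivAt_prod_fst {E F : Type*} [NormedAddCommGroup E] [NormedSpace ℝ E]
    [NormedAddCommGroup F] [NormedSpace ℝ F] {p : ℝ → E × F} {p' : E × F} {r : ℝ}
    (h : HasDerivAt p p' r) : HasDerivAt (fun r => (p r).1) p'.1 r :=
  (ContinuousLinearMap.fst ℝ E F).hasFDerivAt.comp_hasDerivAt r h

theorem hasDerivAt_prod_snd {E F : Type*} [NormedAddCommGroup E] [NormedSpace ℝ E]
    [NormedAddCommGroup F] [NormedSpace ℝ F] {p : ℝ → E × F} {p' : E × F} {r : ℝ}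
    (h : HasDerivAt p p' r) : HasDerivAt (fun r => (p r).2) p'.2 r :=
  (ContinuousLinearMap.snd ℝ E F).hasFDerivAt.comp_hasDerivAt r h

/-- The curve `p = (f, g)` solves `f' + (2/r) ψ(f,g) = X₁(f,g)`, `g' = X₂(f,g)` on `[0, T]` with
initial value `(0, x)`. -/
def IsSingularSol (X : ℝ × ℝ → ℝ × ℝ) (ψ : ℝ × ℝ → ℝ) (x : ℝ) (p : ℝ → ℝ × ℝ) (T : ℝ) : Prop :=
  p 0 = (0, x) ∧ ContinuousOn p (Icc 0 T) ∧
    ∀ r ∈ Ioc 0 T, HasDerivAt p (X (p r) - (2 / r * ψ (p r), 0)) r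

/-- The rescaled primitive `r ↦ r ^ (-k) ∫₀ʳ s ^ k h(s) ds`, written so as to make sense at `0`. -/
def weightedPrimitive (k : ℕ) (h : ℝ → ℝ) (r : ℝ) : ℝ :=
  r * ∫ t in (0 : ℝ)..1, t ^ k * h (r * t)

theorem continuous_weightedPrimitive (k : ℕ) {h : ℝ → ℝ} (hh : Continuous h) :
    Continuous (weightedPrimitive k h) := by
  refine continuous_id.mul ?_
  apply intervalIntegral.continuous_parametric_intervalIntegral_of_continuous'
  simp only [Function.uncurry_def]
  fun_prop

theorem weightedPrimitive_zero (k : ℕ) (h : ℝ → ℝ) : weightedPrimitive k h 0 = 0 := by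
  simp [weightedPrimitive]

theorem pow_mul_weightedPrimitive (k : ℕ) (h : ℝ → ℝ) (r : ℝ) :
    r ^ k * weightedPrimitive k h r = ∫ s in (0 : ℝ)..r, s ^ k * h s := by
  have := intervalIntegral.mul_integral_comp_mul_left (a := 0) (b := 1)
    (f := fun s => s ^ k * h s) r
  simp only [mul_zero, mul_one] at this
  rw [← this, weightedPrimitive, mul_left_comm, ← intervalIntegral.integral_const_mul]
  simp only [mul_pow, mul_assoc]

theorem hasDerivAt_weightedPrimitive (k : ℕ) {h : ℝ → ℝ} (hh : Continuous h) {r : ℝ} (hr : 0 < r) :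
    HasDerivAt (weightedPrimitive k h) (h r - k / r * weightedPrimitive k h r) r := by
  have hint : HasDerivAt (fun y => ∫ s in (0 : ℝ)..y, s ^ k * h s) (r ^ k * h r) r :=
    (Continuous.integral_hasStrictDerivAt (by fun_prop) 0 r).hasDerivAt
  have hquot := hint.div (hasDerivAt_pow k r) (pow_pos hr k).ne'
  have heq : weightedPrimitive k h =ᶠ[𝓝 r]
      (fun y => ∫ s in (0 : ℝ)..y, s ^ k * h s) / fun y => y ^ k := by
    filter_upwards [lt_mem_nhds hr] with y hy
    rw [Pi.div_apply, ← pow_mul_weightedPrimitive, mul_div_cancel_left₀ _ (pow_pos hy k).ne']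
  refine (hquot.congr_of_eventuallyEq heq).congr_deriv ?_
  rw [← pow_mul_weightedPrimitive]
  have := hr.ne'
  rcases k with _ | k
  · simp
  · simp only [Nat.add_sub_cancel]
    field_simp
    ring

theorem abs_weightedPrimitive_sub_le (k : ℕ) {h h' : ℝ → ℝ} (hh : Continuous h)
    (hh' : Continuous h') {r B : ℝ} (hr : 0 ≤ r) (hB : ∀ s, |h s - h' s| ≤ B) :
    |weightedPrimitive k h r - weightedPrimitive k h' r| ≤ r * B := by
  rw [weightedPrimitive, weightedPrimitive, ← mul_sub, abs_mul, abs_of_nonneg hr,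
    ← intervalIntegral.integral_sub (Continuous.intervalIntegrable (by fun_prop) _ _)
      (Continuous.intervalIntegrable (by fun_prop) _ _)]
  gcongr
  have := intervalIntegral.norm_integral_le_of_norm_le_const (a := 0) (b := 1) (C := B)
    (f := fun t => t ^ k * h (r * t) - t ^ k * h' (r * t)) ?_
  · simpa using this
  · intro t ht
    rw [uIoc_of_le zero_le_one] at ht
    rw [← mul_sub, norm_mul, Real.norm_eq_abs, Real.norm_eq_abs,
      abs_of_nonneg (pow_nonneg ht.1.le k)]
    exact (mul_le_of_le_one_left (abs_nonneg _) (pow_le_one₀ ht.1.le ht.2)).trans (hB _)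

/-- For a globally Lipschitz field and `ψ(f,g) = f`, a solution near `0` is obtained as a fixed point
of the integral operator built from `weightedPrimitive`. -/
theorem exists_singularSol_of_lipschitz {Y : ℝ × ℝ → ℝ × ℝ} {K : NNReal} (hY : LipschitzWith K Y)
    {τ : ℝ} (hτ : 0 < τ) (hK : τ * K ≤ 1 / 2) (x : ℝ) :
    ∃ p : ℝ → ℝ × ℝ, Continuous p ∧ p 0 = (0, x) ∧
      ∀ r ∈ Ioo 0 τ, HasDerivAt p (Y (p r) - (2 / r * (p r).1, 0)) r := by
  let extend (u : C(Icc 0 τ, ℝ × ℝ)) : ℝ → ℝ × ℝ := IccExtend hτ.le u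
  have hext (u) : Continuous (fun s => Y (extend u s)) := hY.continuous.comp u.continuous.Icc_extend'
  let P (u : C(Icc 0 τ, ℝ × ℝ)) (r : ℝ) : ℝ × ℝ :=
    (weightedPrimitive 2 (fun s => (Y (extend u s)).1) r,
      x + weightedPrimitive 0 (fun s => (Y (extend u s)).2) r)
  have hP (u) : Continuous (P u) :=
    (continuous_weightedPrimitive 2 (hext u).fst).prodMk
      (continuous_const.add (continuous_weightedPrimitive 0 (hext u).snd))
  let Φ (u : C(Icc 0 τ, ℝ × ℝ)) : C(Icc 0 τ, ℝ × ℝ) := ⟨fun r => P u r, by have := hP u; fun_prop⟩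
  have hdist (u v) (s : ℝ) : dist (Y (extend u s)) (Y (extend v s)) ≤ K * dist u v :=
    (hY.dist_le_mul _ _).trans (by gcongr; exact ContinuousMap.dist_apply_le_dist _)
  have hΦ : ContractingWith (1 / 2) Φ := by
    refine ⟨by norm_num, LipschitzWith.of_dist_le_mul fun u v => ?_⟩
    rw [ContinuousMap.dist_le (by positivity)]
    rintro ⟨r, hr⟩
    have hbound : r * (K * dist u v) ≤ ((1 / 2 : NNReal) : ℝ) * dist u v := by
      rw [← mul_assoc]
      gcongr
      refine (mul_le_mul_of_nonneg_right hr.2 K.2).trans (hK.trans (by simp))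
    refine (max_le ?_ ?_ : dist (P u r) (P v r) ≤ _)
    · exact (abs_weightedPrimitive_sub_le 2 (hext u).fst (hext v).fst hr.1 fun s =>
        (le_max_left _ _).trans (hdist u v s)).trans hbound
    · dsimp only [P]
      rw [dist_add_left]
      exact (abs_weightedPrimitive_sub_le 0 (hext u).snd (hext v).snd hr.1 fun s =>
        (le_max_right _ _).trans (hdist u v s)).trans hbound
  have hfix := hΦ.fixedPoint_isFixedPt
  set u := hΦ.fixedPoint
  have heq (r : ℝ) (hr : r ∈ Icc 0 τ) : extend u r = P u r := by
    rw [show extend u r = u ⟨r, hr⟩ from IccExtend_of_mem _ _ hr]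
    exact (DFunLike.congr_fun hfix ⟨r, hr⟩).symm
  refine ⟨P u, hP u, by simp [P, weightedPrimitive_zero], fun r hr => ?_⟩
  have h₁ := hasDerivAt_weightedPrimitive 2 (hext u).fst hr.1
  have h₂ := (hasDerivAt_weightedPrimitive 0 (hext u).snd hr.1).const_add x
  refine (h₁.prodMk h₂).congr_deriv ?_
  rw [← heq r (Ioo_subset_Icc_self hr)]
  ext
  · simp [heq r (Ioo_subset_Icc_self hr), P]
  · simp

section SingularSystem

variable {X : ℝ × ℝ → ℝ × ℝ} {ψ : ℝ × ℝ → ℝ} {c : ℝ}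

theorem exists_isSingularSol (hX : ContDiff ℝ 1 X) (hc : 0 < c)
    (hψc : ∀ q : ℝ × ℝ, |q.1| ≤ c → ψ q = q.1) (x : ℝ) :
    ∃ T > 0, ∃ p, IsSingularSol X ψ x p T := by
  have h₁ : (-1 : ℝ) ≤ 1 := by norm_num
  have h₂ : x - 1 ≤ x + 1 := by linarith
  let clamp (q : ℝ × ℝ) : ℝ × ℝ := (projIcc (-1) 1 h₁ q.1, projIcc (x - 1) (x + 1) h₂ q.2)
  have hclamp : LipschitzWith 1 clamp := by
    have := (LipschitzWith.subtype_val _).comp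
      ((LipschitzWith.projIcc h₁).comp (LipschitzWith.prod_fst (α := ℝ) (β := ℝ)))
    have := this.prodMk ((LipschitzWith.subtype_val _).comp
      ((LipschitzWith.projIcc h₂).comp (LipschitzWith.prod_snd (α := ℝ) (β := ℝ))))
    simpa using this
  obtain ⟨K, hK⟩ := LocallyLipschitzOn.exists_lipschitzOnWith_of_compact
    (s := Icc (-1 : ℝ) 1 ×ˢ Icc (x - 1) (x + 1)) (isCompact_Icc.prod isCompact_Icc)
    hX.locallyLipschitz.locallyLipschitzOn
  have hY : LipschitzWith K (X ∘ clamp) := by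
    have := hK.comp (hclamp.lipschitzOnWith (s := univ)) fun q _ =>
      ⟨Subtype.coe_prop _, Subtype.coe_prop _⟩
    simpa using this
  have hτ : (0 : ℝ) < 1 / (2 * (K + 1)) := by positivity
  obtain ⟨p, hp, hp0, hderiv⟩ := exists_singularSol_of_lipschitz hY hτ
    (by rw [div_mul_eq_mul_div, div_le_div_iff₀ (by positivity) (by norm_num)]; linarith) x
  have hnhds : ∀ᶠ r in 𝓝 (0 : ℝ), |(p r).1| ≤ c ∧ clamp (p r) = p r := by
    have hp₁ : Tendsto (fun r => (p r).1) (𝓝 0) (𝓝 0) := hp.fst.tendsto' _ _ (by simp [hp0])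
    have hp₂ : Tendsto (fun r => (p r).2) (𝓝 0) (𝓝 x) := hp.snd.tendsto' _ _ (by simp [hp0])
    filter_upwards [hp₁ (Icc_mem_nhds (neg_lt_zero.2 hc) hc),
      hp₁ (Icc_mem_nhds (show (-1 : ℝ) < 0 by norm_num) one_pos),
      hp₂ (Icc_mem_nhds (sub_one_lt x) (lt_add_one x))] with r hr₁ hr₂ hr₃
    refine ⟨abs_le.2 hr₁, Prod.ext ?_ ?_⟩
    · exact congrArg Subtype.val (projIcc_of_mem h₁ hr₂)
    · exact congrArg Subtype.val (projIcc_of_mem h₂ hr₃)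
  obtain ⟨δ, hδ, hball⟩ := Metric.eventually_nhds_iff.1 hnhds
  have hT : 0 < min (1 / (2 * ((K : ℝ) + 1))) δ := lt_min hτ hδ
  refine ⟨_, half_pos hT, p, hp0, hp.continuousOn, fun r hr => ?_⟩
  have hlt : r < min (1 / (2 * ((K : ℝ) + 1))) δ := hr.2.trans_lt (half_lt_self hT)
  obtain ⟨hsmall, hfix⟩ := hball (y := r)
    (by rw [dist_zero_right, Real.norm_of_nonneg hr.1.le]; exact hlt.trans_le (min_le_right _ _))
  have := hderiv r ⟨hr.1, hlt.trans_le (min_le_left _ _)⟩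
  rwa [Function.comp_apply, hfix, ← hψc _ hsmall] at this

theorem IsSingularSol.mono {x T T' : ℝ} {p : ℝ → ℝ × ℝ} (h : IsSingularSol X ψ x p T)
    (hT : T' ≤ T) : IsSingularSol X ψ x p T' :=
  ⟨h.1, h.2.1.mono (Icc_subset_Icc_right hT), fun r hr => h.2.2 r ⟨hr.1, hr.2.trans hT⟩⟩

/-- Uniqueness: near `0` the singular term is dissipative, so the squared distance of two solutions
satisfies a Gronwall inequality on all of `[0, T]`. -/
theorem IsSingularSol.eqOn (hX : ContDiff ℝ 1 X) (hψ : ContDiff ℝ 1 ψ) (hc : 0 < c)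
    (hψc : ∀ q : ℝ × ℝ, |q.1| ≤ c → ψ q = q.1) {x T : ℝ} {p q : ℝ → ℝ × ℝ}
    (hp : IsSingularSol X ψ x p T) (hq : IsSingularSol X ψ x q T) : EqOn p q (Icc 0 T) := by
  have hcompact : IsCompact (p '' Icc 0 T ∪ q '' Icc 0 T) :=
    (isCompact_Icc.image_of_continuousOn hp.2.1).union (isCompact_Icc.image_of_continuousOn hq.2.1)
  obtain ⟨L, hL⟩ := LocallyLipschitzOn.exists_lipschitzOnWith_of_compact hcompact
    hX.locallyLipschitz.locallyLipschitzOn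
  obtain ⟨M, hM⟩ := LocallyLipschitzOn.exists_lipschitzOnWith_of_compact hcompact
    hψ.locallyLipschitz.locallyLipschitzOn
  intro s hs
  have h0T : (0 : ℝ) ∈ Icc 0 T := ⟨le_rfl, hs.1.trans hs.2⟩
  have small {w : ℝ → ℝ × ℝ} (hw : IsSingularSol X ψ x w T) :
      ∀ᶠ r in 𝓝[Icc 0 T] 0, |(w r).1| ≤ c := by
    have : Tendsto (fun r => (w r).1) (𝓝[Icc 0 T] 0) (𝓝 0) := by
      have := (hw.2.1 0 h0T).fst
      rwa [ContinuousWithinAt, hw.1] at this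
    filter_upwards [this (Icc_mem_nhds (neg_lt_zero.2 hc) hc)] with r hr using abs_le.2 hr
  obtain ⟨r₀, hr₀, hsmall⟩ := Metric.mem_nhdsWithin_iff.1 ((small hp).and (small hq))
  let u (r : ℝ) : ℝ := (p r).1 - (q r).1
  let v (r : ℝ) : ℝ := (p r).2 - (q r).2
  let C : ℝ := 4 * L + 8 * M / r₀
  let E (r : ℝ) : ℝ := (u r ^ 2 + v r ^ 2) * Real.exp (-C * r)
  have hanti : AntitoneOn E (Icc 0 T) := by
    refine antitoneOn_of_hasDerivWithinAt_nonpos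
      (f' := fun r => (2 * u r * ((X (p r)).1 - (X (q r)).1 - 2 / r * (ψ (p r) - ψ (q r))) +
          2 * v r * ((X (p r)).2 - (X (q r)).2) - C * (u r ^ 2 + v r ^ 2)) * Real.exp (-C * r))
      (convex_Icc 0 T) ?_ ?_ ?_
    · have hp' := hp.2.1
      have hq' := hq.2.1
      have hu : ContinuousOn u (Icc 0 T) := hp'.fst.sub hq'.fst
      have hv : ContinuousOn v (Icc 0 T) := hp'.snd.sub hq'.snd
      exact ((hu.pow 2).add (hv.pow 2)).mul (by fun_prop)
    · intro r hr
      rw [interior_Icc] at hr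
      have hpr := hp.2.2 r (Ioo_subset_Ioc_self hr)
      have hqr := hq.2.2 r (Ioo_subset_Ioc_self hr)
      have hu : HasDerivAt u _ r := (hasDerivAt_prod_fst hpr).sub (hasDerivAt_prod_fst hqr)
      have hv : HasDerivAt v _ r := (hasDerivAt_prod_snd hpr).sub (hasDerivAt_prod_snd hqr)
      have hexp : HasDerivAt (fun r => Real.exp (-C * r)) (Real.exp (-C * r) * (-C * 1)) r :=
        ((hasDerivAt_id r).const_mul (-C)).exp
      refine ((((hu.pow 2).add (hv.pow 2)).mul hexp).congr_deriv ?_).hasDerivWithinAt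
      simp
      ring
    · intro r hr
      rw [interior_Icc] at hr
      refine mul_nonpos_of_nonpos_of_nonneg ?_ (Real.exp_pos _).le
      have hrT := Ioo_subset_Icc_self hr
      have hpK : p r ∈ p '' Icc 0 T ∪ q '' Icc 0 T := Or.inl ⟨r, hrT, rfl⟩
      have hqK : q r ∈ p '' Icc 0 T ∪ q '' Icc 0 T := Or.inr ⟨r, hrT, rfl⟩
      have hd : dist (p r) (q r) ≤ |u r| + |v r| :=
        max_le (le_add_of_nonneg_right (abs_nonneg _)) (le_add_of_nonneg_left (abs_nonneg _))
      have hXd : dist (X (p r)) (X (q r)) ≤ L * (|u r| + |v r|) :=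
        (hL.dist_le_mul _ hpK _ hqK).trans (by gcongr)
      have hX₁ : |(X (p r)).1 - (X (q r)).1| ≤ L * (|u r| + |v r|) :=
        (le_max_left _ _).trans hXd
      have hX₂ : |(X (p r)).2 - (X (q r)).2| ≤ L * (|u r| + |v r|) :=
        (le_max_right _ _).trans hXd
      have hψd : |ψ (p r) - ψ (q r)| ≤ M * (|u r| + |v r|) :=
        (hM.dist_le_mul _ hpK _ hqK).trans (by gcongr)
      have hmul {y z B : ℝ} (hz : |z| ≤ B) : y * z ≤ |y| * B :=
        (le_abs_self _).trans ((abs_mul y z).trans_le (by gcongr))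
      have hreg : u r * ((X (p r)).1 - (X (q r)).1) + v r * ((X (p r)).2 - (X (q r)).2) ≤
          2 * L * (u r ^ 2 + v r ^ 2) := by
        have h₁ := hmul (y := u r) hX₁
        have h₂ := hmul (y := v r) hX₂
        have : (L : ℝ) * (|u r| + |v r|) ^ 2 ≤ L * (2 * (u r ^ 2 + v r ^ 2)) := by
          gcongr
          nlinarith [sq_nonneg (|u r| - |v r|), sq_abs (u r), sq_abs (v r)]
        linarith
      have hsing : -(u r * (ψ (p r) - ψ (q r))) / r ≤ 2 * M / r₀ * (u r ^ 2 + v r ^ 2) := by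
        rcases lt_or_ge r r₀ with hlt | hge
        · obtain ⟨hpc, hqc⟩ := hsmall ⟨by simpa [abs_of_pos hr.1] using hlt, hrT⟩
          rw [hψc _ hpc, hψc _ hqc]
          have h₁ : -(u r * u r) / r ≤ 0 :=
            div_nonpos_of_nonpos_of_nonneg (by nlinarith [mul_self_nonneg (u r)]) hr.1.le
          exact h₁.trans (by positivity)
        · have h₁ : -(u r * (ψ (p r) - ψ (q r))) ≤ 2 * M * (u r ^ 2 + v r ^ 2) := by
            have h₁ := hmul (y := -u r) hψd
            have : (M : ℝ) * (|u r| * (|u r| + |v r|)) ≤ M * (2 * (u r ^ 2 + v r ^ 2)) := by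
              refine mul_le_mul_of_nonneg_left ?_ M.2
              nlinarith [sq_nonneg (|u r| - |v r|), sq_abs (u r), sq_abs (v r)]
            rw [abs_neg] at h₁
            linarith
          calc _ ≤ 2 * M * (u r ^ 2 + v r ^ 2) / r := by gcongr; exact hr.1.le
            _ ≤ 2 * M * (u r ^ 2 + v r ^ 2) / r₀ := by gcongr
            _ = _ := by ring
      simp only [C]
      have h₁ : 2 * u r * (2 / r * (ψ (p r) - ψ (q r))) =
        -(4 * (-(u r * (ψ (p r) - ψ (q r))) / r)) := by ring
      have h₂ : 8 * (M : ℝ) / r₀ * (u r ^ 2 + v r ^ 2) =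
        4 * (2 * M / r₀ * (u r ^ 2 + v r ^ 2)) := by ring
      linarith
  have hE := hanti h0T hs hs.1
  have hE0 : E 0 = 0 := by simp [E, u, v, hp.1, hq.1]
  rw [hE0] at hE
  have hsum : u s ^ 2 + v s ^ 2 ≤ 0 := nonpos_of_mul_nonpos_left hE (Real.exp_pos _)
  have hu : u s = 0 := by nlinarith [sq_nonneg (u s), sq_nonneg (v s)]
  have hv : v s = 0 := by nlinarith [sq_nonneg (u s), sq_nonneg (v s)]
  exact Prod.ext (sub_eq_zero.1 hu) (sub_eq_zero.1 hv)

/-- Solutions passing sufficiently close to `(R, p₀)` extend beyond time `R`. -/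
theorem exists_isSingularSol_past (hX : ContDiff ℝ 1 X) (hψ : ContDiff ℝ 1 ψ) {R : ℝ} (hR : 0 < R)
    (p₀ : ℝ × ℝ) (x : ℝ) :
    ∃ ε > 0, ∀ r ∈ Ioc (R - ε) R, 0 < r → ∀ p, IsSingularSol X ψ x p r → dist (p r) p₀ < ε →
      ∃ T > R, ∃ q, IsSingularSol X ψ x q T := by
  let Z (z : ℝ × ℝ × ℝ) : ℝ × ℝ × ℝ := (1, X z.2 - (2 / z.1 * ψ z.2, 0))
  have hZ : ContDiffAt ℝ 1 Z (R, p₀) := by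
    refine contDiffAt_const.prodMk ((hX.comp contDiff_snd).contDiffAt.sub ?_)
    exact ((contDiffAt_const.div contDiffAt_fst hR.ne').mul
      (hψ.comp contDiff_snd).contDiffAt).prodMk contDiffAt_const
  obtain ⟨δ, hδ, ε, hε, hflow⟩ :=
    hZ.exists_forall_mem_closedBall_exists_eq_forall_mem_Ioo_hasDerivAt 0
  refine ⟨min δ (ε / 2), lt_min hδ (half_pos hε), fun r hr hr0 p hp hdist => ?_⟩
  have hrR : R - r < min δ (ε / 2) := by linarith [hr.1]
  obtain ⟨α, hα0, hα⟩ := hflow (r, p r) (by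
    refine max_le ?_ (hdist.trans_le (min_le_left _ _)).le
    rw [Real.dist_eq, abs_sub_comm, abs_of_nonneg (sub_nonneg.2 hr.2)]
    exact (hrR.trans_le (min_le_left _ _)).le)
  have htime : ∀ t ∈ Ioo (-ε) ε, (α t).1 = r + t := by
    have hconst : ∀ t ∈ Ioo (-ε) ε, HasDerivAt (fun t => (α t).1 - t) 0 t := fun t ht => by
      have := (hasDerivAt_prod_fst (hα t (by simpa using ht))).sub (hasDerivAt_id t)
      exact this.congr_deriv (by simp [Z])
    intro t ht
    have := (isOpen_Ioo.is_const_of_deriv_eq_zero isPreconnected_Ioo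
      (fun t ht => (hconst t ht).differentiableAt.differentiableWithinAt)
      (fun t ht => (hconst t ht).deriv) ht ⟨neg_lt_zero.2 hε, hε⟩ : (α t).1 - t = (α 0).1 - 0)
    rw [hα0] at this
    linarith
  let β (s : ℝ) : ℝ × ℝ := (α (s - r)).2
  have hβr : β r = p r := by simp [β, hα0]
  have hβ : ∀ s ∈ Ioo (r - ε) (r + ε), HasDerivAt β (X (β s) - (2 / s * ψ (β s), 0)) s := by
    intro s hs
    have hs' : s - r ∈ Ioo (-ε) ε := ⟨by linarith [hs.1], by linarith [hs.2]⟩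
    have := HasDerivAt.comp_sub_const s r (hasDerivAt_prod_snd (hα (s - r) (by simpa using hs')))
    simpa only [Z, htime _ hs', add_sub_cancel] using this
  classical
  let q (s : ℝ) : ℝ × ℝ := if s ≤ r then p s else β s
  have hqp : EqOn q p (Iic r) := fun s hs => if_pos hs
  have hqβ : EqOn q β (Ici r) := fun s hs => by
    rcases eq_or_lt_of_le (mem_Ici.1 hs) with rfl | hlt
    · simp [q, hβr]
    · exact if_neg hlt.not_ge
  have hderiv : ∀ s ∈ Ioo 0 (r + ε), HasDerivAt q (X (q s) - (2 / s * ψ (q s), 0)) s := by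
    intro s hs
    have hleft (hsr : s ≤ r) :
        HasDerivWithinAt q (X (q s) - (2 / s * ψ (q s), 0)) (Iic r) s := by
      rw [hqp hsr]
      exact (hp.2.2 s ⟨hs.1, hsr⟩).hasDerivWithinAt.congr hqp (hqp hsr)
    have hright (hsr : r ≤ s) :
        HasDerivWithinAt q (X (q s) - (2 / s * ψ (q s), 0)) (Ici r) s := by
      rw [hqβ hsr]
      exact (hβ s ⟨by linarith, hs.2⟩).hasDerivWithinAt.congr hqβ (hqβ hsr)
    rcases lt_trichotomy s r with hlt | rfl | hgt
    · exact (hleft hlt.le).hasDerivAt (Iic_mem_nhds hlt)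
    · have := (hleft le_rfl).union (hright le_rfl)
      rwa [Iic_union_Ici, hasDerivWithinAt_univ] at this
    · exact (hright hgt.le).hasDerivAt (Ici_mem_nhds hgt)
  refine ⟨r + ε / 2, by linarith [hrR.trans_le (min_le_right _ _)], q,
    (hqp hr0.le).trans hp.1, ?_, fun s hs => hderiv s ⟨hs.1, by linarith [hs.2]⟩⟩
  intro s hs
  rcases eq_or_lt_of_le hs.1 with rfl | hpos
  · have hcont : ContinuousWithinAt p (Icc 0 r) 0 := hp.2.1 0 ⟨le_rfl, hr0.le⟩
    have : ContinuousWithinAt q (Icc 0 r) 0 :=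
      hcont.congr (fun y hy => hqp hy.2) (hqp hr0.le)
    refine this.mono_of_mem_nhdsWithin ?_
    filter_upwards [self_mem_nhdsWithin, mem_nhdsWithin_of_mem_nhds (Iic_mem_nhds hr0)]
      with y hy hyr using ⟨hy.1, hyr⟩
  · exact (hderiv s ⟨hpos, by linarith [hs.2]⟩).continuousAt.continuousWithinAt

theorem exists_maximal_isSingularSol (hX : ContDiff ℝ 1 X) (hψ : ContDiff ℝ 1 ψ) (hc : 0 < c)
    (hψc : ∀ q : ℝ × ℝ, |q.1| ≤ c → ψ q = q.1) (x : ℝ) :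
    ∃ P : ℝ → ℝ × ℝ, (∀ T, IsSingularSol X ψ x P T) ∨
      ∃ R > 0, (∀ T < R, IsSingularSol X ψ x P T) ∧
        Tendsto (fun r => |(P r).1| + |(P r).2|) (𝓝[<] R) atTop := by
  classical
  let S : Set ℝ := {T | 0 < T ∧ ∃ p, IsSingularSol X ψ x p T}
  choose! p hp using fun T (hT : T ∈ S) => hT.2
  let P (r : ℝ) : ℝ × ℝ := if r ∈ S then p r r else (0, x)
  have hP0 : P 0 = (0, x) := if_neg fun h => lt_irrefl _ h.1
  have hdown {T T' : ℝ} (hT : T ∈ S) (h0 : 0 < T') (h : T' ≤ T) : T' ∈ S :=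
    ⟨h0, p T, (hp T hT).mono h⟩
  have hPeq {T : ℝ} (hT : T ∈ S) : EqOn P (p T) (Icc 0 T) := by
    intro r hr
    rcases eq_or_lt_of_le hr.1 with rfl | hpos
    · rw [hP0, (hp T hT).1]
    · have hrS := hdown hT hpos hr.2
      rw [show P r = p r r from if_pos hrS]
      exact (hp r hrS).eqOn hX hψ hc hψc ((hp T hT).mono hr.2) ⟨hpos.le, le_rfl⟩
  have hopen {T : ℝ} (hT : T ∈ S) : ∃ T' ∈ S, T < T' := by
    obtain ⟨ε, hε, h⟩ := exists_isSingularSol_past hX hψ hT.1 (p T T) x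
    obtain ⟨T', hTT', q, hq⟩ := h T ⟨by linarith, le_rfl⟩ hT.1 (p T) (hp T hT) (by simpa using hε)
    exact ⟨T', ⟨hT.1.trans hTT', q, hq⟩, hTT'⟩
  have hPsol {T : ℝ} (hT : T ∈ S) : IsSingularSol X ψ x P T := by
    refine ⟨hP0, (hp T hT).2.1.congr (hPeq hT), fun r hr => ?_⟩
    obtain ⟨T', hT', hTT'⟩ := hopen hT
    have hrT' : r < T' := hr.2.trans_lt hTT'
    rw [hPeq hT' ⟨hr.1.le, hrT'.le⟩]
    refine ((hp T' hT').2.2 r ⟨hr.1, hrT'.le⟩).congr_of_eventuallyEq ?_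
    filter_upwards [Ioo_mem_nhds hr.1 hrT'] with y hy using hPeq hT' (Ioo_subset_Icc_self hy)
  obtain ⟨T₀, hT₀, p₀, hp₀⟩ := exists_isSingularSol hX hc hψc x
  have hT₀S : T₀ ∈ S := ⟨hT₀, p₀, hp₀⟩
  refine ⟨P, ?_⟩
  by_cases hbdd : BddAbove S
  · right
    set R := sSup S
    have hlt {T : ℝ} (hT : T ∈ S) : T < R := by
      obtain ⟨T', hT', hTT'⟩ := hopen hT
      exact hTT'.trans_le (le_csSup hbdd hT')
    have hmem {T : ℝ} (h0 : 0 < T) (hT : T < R) : T ∈ S := by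
      obtain ⟨T', hT', hTT'⟩ := exists_lt_of_lt_csSup ⟨T₀, hT₀S⟩ hT
      exact hdown hT' h0 hTT'.le
    have hR : 0 < R := hT₀.trans (hlt hT₀S)
    refine ⟨R, hR, fun T hT => ?_, ?_⟩
    · have : max T (R / 2) < R := max_lt hT (half_lt_self hR)
      exact (hPsol (hmem (lt_max_of_lt_right (half_pos hR)) this)).mono (le_max_left _ _)
    · rw [tendsto_atTop]
      by_contra! hB
      obtain ⟨B, hB⟩ := hB
      have hfreq : ∃ᶠ r in 𝓝[<] R, P r ∈ Metric.closedBall (0 : ℝ × ℝ) B := by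
        refine hB.mono fun r hr => ?_
        rw [mem_closedBall_zero_iff]
        exact max_le (by rw [Real.norm_eq_abs]; linarith [abs_nonneg (P r).2])
          (by rw [Real.norm_eq_abs]; linarith [abs_nonneg (P r).1])
      obtain ⟨y, -, hy⟩ :=
        (isCompact_closedBall (0 : ℝ × ℝ) B).exists_mapClusterPt_of_frequently hfreq
      obtain ⟨ε, hε, h⟩ := exists_isSingularSol_past hX hψ hR y x
      have hnear := hy.frequently (Metric.ball_mem_nhds y hε)
      have hevent : ∀ᶠ r in 𝓝[<] R, r ∈ Ioo (max 0 (R - ε)) R :=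
        Ioo_mem_nhdsLT (max_lt hR (by linarith))
      obtain ⟨r, hry, hr⟩ := (hnear.and_eventually hevent).exists
      have hr0 : 0 < r := (le_max_left _ _).trans_lt hr.1
      obtain ⟨T, hT, q, hq⟩ := h r ⟨(le_max_right _ _).trans_lt hr.1, hr.2.le⟩ hr0 P
        (hPsol (hmem hr0 hr.2)) hry
      exact (hlt ⟨hR.trans hT, q, hq⟩).not_gt hT
  · left
    intro T
    obtain ⟨T', hT', hTT'⟩ := not_bddAbove_iff.1 hbdd T
    exact (hPsol hT').mono hTT'.le

end SingularSystem

/-- The nonsingular part of the regularized system. -/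
def regField (a b : ℝ) (q : ℝ × ℝ) : ℝ × ℝ :=
  (q.2 * (q.1 ^ 2 - a * q.2 ^ 2 + b), q.1 * (1 - q.2 ^ 2))

theorem contDiff_regField (a b : ℝ) : ContDiff ℝ 1 (regField a b) := by
  unfold regField
  fun_prop

theorem IsCutoff.contDiff {a b η : ℝ} (hη : 0 < η) {φ : ℝ → ℝ → ℝ}
    (hφ : IsCutoff a b η φ) : ContDiff ℝ 1 (fun q : ℝ × ℝ => φ q.1 q.2) := by
  rw [contDiff_iff_contDiffAt]
  intro q
  by_cases hq : |q.1| < √(a - b)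
  · refine (hφ.2.1.contDiffAt ?_).of_le (by exact_mod_cast le_top)
    exact (isOpen_Ioo.prod isOpen_univ).mem_nhds ⟨abs_lt.1 hq, mem_univ _⟩
  · refine (contDiffAt_const (c := (0 : ℝ))).congr_of_eventuallyEq ?_
    have hcont : Continuous fun z : ℝ × ℝ => |z.1| := continuous_fst.abs
    filter_upwards [hcont.continuousAt.eventually
      (lt_mem_nhds (show √(a - b) - η / 2 < |q.1| by linarith))] with z hz
    exact hφ.2.2.2.1 _ _ hz.le

theorem isRegSolOn_iff_hasDerivAt {a b x : ℝ} {φ : ℝ → ℝ → ℝ} {p : ℝ → ℝ × ℝ} {s : Set ℝ} :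
    IsRegSolOn a b φ x (fun r => (p r).1) (fun r => (p r).2) s ↔
      p 0 = (0, x) ∧ ContinuousOn p s ∧ ∀ r ∈ s, 0 < r →
        HasDerivAt p (regField a b (p r) - (2 / r * (φ (p r).1 (p r).2 * (p r).1), 0)) r := by
  constructor
  · rintro ⟨hf0, hg0, hf, hg, h⟩
    refine ⟨Prod.ext hf0 hg0, hf.prodMk hg, fun r hr h0 => ?_⟩
    refine ((h r hr h0).1.prodMk (h r hr h0).2).congr_deriv ?_
    ext
    · simp [regField]
      ring
    · simp [regField]
  · rintro ⟨h0, hcont, h⟩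
    refine ⟨congrArg Prod.fst h0, congrArg Prod.snd h0, hcont.fst, hcont.snd, fun r hr hpos => ⟨?_, ?_⟩⟩
    · refine (hasDerivAt_prod_fst (h r hr hpos)).congr_deriv ?_
      simp [regField]
      ring
    · refine (hasDerivAt_prod_snd (h r hr hpos)).congr_deriv ?_
      simp [regField]

theorem isRegSolOn_iff_isSingularSol {a b x T : ℝ} {φ : ℝ → ℝ → ℝ} {p : ℝ → ℝ × ℝ} :
    IsRegSolOn a b φ x (fun r => (p r).1) (fun r => (p r).2) (Icc 0 T) ↔
      IsSingularSol (regField a b) (fun q => φ q.1 q.2 * q.1) x p T := by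
  rw [isRegSolOn_iff_hasDerivAt]
  exact and_congr_right fun _ => and_congr_right fun _ =>
    ⟨fun h r hr => h r ⟨hr.1.le, hr.2⟩ hr.1, fun h r hr h0 => h r ⟨h0, hr.2⟩⟩

/-- Lemma 2.1: local existence and uniqueness for the regularized
system, and extension to a maximal interval which is either `[0,∞)` or `[0,R)` with
blow-up at `R`. -/
theorem local_existence_uniqueness (a b η : ℝ) (ha : 0 < a) (hb : 0 < b)
    (hη : η ∈ Ioo 0 (Real.sqrt (a - b) - Real.sqrt (a / 2)))
    (φ : ℝ → ℝ → ℝ) (hφ : IsCutoff a b η φ) (x : ℝ) :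
    ∃ τ > 0, ∃ f g : ℝ → ℝ,
      IsRegSolOn a b φ x f g (Icc 0 τ) ∧
      (∀ f' g' : ℝ → ℝ, IsRegSolOn a b φ x f' g' (Icc 0 τ) →
        EqOn f' f (Icc 0 τ) ∧ EqOn g' g (Icc 0 τ)) ∧
      ∃ F G : ℝ → ℝ, EqOn F f (Icc 0 τ) ∧ EqOn G g (Icc 0 τ) ∧
        (IsRegSolOn a b φ x F G (Ici 0) ∨
          ∃ R, τ < R ∧ IsRegSolOn a b φ x F G (Ico 0 R) ∧
            Tendsto (fun r => |F r| + |G r|) (nhdsWithin R (Iio R)) atTop) := by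
  have hc : 0 < √(a - b) - η := by linarith [hη.2, Real.sqrt_nonneg (a / 2)]
  have hX := contDiff_regField a b
  have hψ : ContDiff ℝ 1 (fun q : ℝ × ℝ => φ q.1 q.2 * q.1) :=
    (hφ.contDiff hη.1).mul contDiff_fst
  have hψc (q : ℝ × ℝ) (hq : |q.1| ≤ √(a - b) - η) : φ q.1 q.2 * q.1 = q.1 := by
    rw [hφ.2.2.2.2 _ _ hq, one_mul]
  obtain ⟨P, hP⟩ := exists_maximal_isSingularSol hX hψ hc hψc x
  obtain ⟨τ, hτ, hPτ, hmax⟩ : ∃ τ > 0,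
      IsSingularSol (regField a b) (fun q => φ q.1 q.2 * q.1) x P τ ∧
      (IsRegSolOn a b φ x (fun r => (P r).1) (fun r => (P r).2) (Ici 0) ∨
        ∃ R, τ < R ∧ IsRegSolOn a b φ x (fun r => (P r).1) (fun r => (P r).2) (Ico 0 R) ∧
          Tendsto (fun r => |(P r).1| + |(P r).2|) (𝓝[<] R) atTop) := by
    rcases hP with hP | ⟨R, hR, hP, hblow⟩
    · refine ⟨1, one_pos, hP 1, Or.inl (isRegSolOn_iff_hasDerivAt.2 ⟨(hP 1).1, ?_, ?_⟩)⟩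
      · intro r hr
        refine ((hP (r + 1)).2.1 r ⟨hr, (lt_add_one r).le⟩).mono_of_mem_nhdsWithin ?_
        filter_upwards [self_mem_nhdsWithin,
          mem_nhdsWithin_of_mem_nhds (Iic_mem_nhds (lt_add_one r))] with y h₁ h₂ using ⟨h₁, h₂⟩
      · exact fun r _ h0 => (hP r).2.2 r ⟨h0, le_rfl⟩
    · refine ⟨R / 2, half_pos hR, hP _ (half_lt_self hR), Or.inr ⟨R, half_lt_self hR,
        isRegSolOn_iff_hasDerivAt.2 ⟨(hP _ (half_lt_self hR)).1, ?_, ?_⟩, hblow⟩⟩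
      · intro r hr
        obtain ⟨T, hrT, hTR⟩ := exists_between hr.2
        refine ((hP T hTR).2.1 r ⟨hr.1, hrT.le⟩).mono_of_mem_nhdsWithin ?_
        filter_upwards [self_mem_nhdsWithin,
          mem_nhdsWithin_of_mem_nhds (Iic_mem_nhds hrT)] with y h₁ h₂ using ⟨h₁.1, h₂⟩
      · exact fun r hr h0 => (hP r hr.2).2.2 r ⟨h0, le_rfl⟩
  refine ⟨τ, hτ, _, _, isRegSolOn_iff_isSingularSol.2 hPτ, fun f' g' h' => ?_,
    _, _, fun _ _ => rfl, fun _ _ => rfl, hmax⟩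
  have heq := IsSingularSol.eqOn hX hψ hc hψc
    (isRegSolOn_iff_isSingularSol (p := fun r => (f' r, g' r)).1 h') hPτ
  exact ⟨fun r hr => congrArg Prod.fst (heq hr), fun r hr => congrArg Prod.snd (heq hr)⟩
end
end

section
/- Let a, b > 0, let η ∈ (0, √(a−b) − √(a/2)), let φ_η be an admissible cutoff, let x ∈ ℝ, and let (f_{x,η}, g_{x,η}) be the solution of the regularized system with f_{x,η}(0) = 0, g_{x,η}(0) = x, defined on its maximal interval [0, R_{x,η}). Then for every r ∈ (0, R_{x,η}), the derivative of r ↦ H(f_{x,η}(r), g_{x,η}(r)) equals −(2φ_η(f_{x,η}(r), g_{x,η}(r))/r) · f_{x,η}(r)² · (1 − g_{x,η}(r)²). -/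
open Real Set Filter Topology

noncomputable section

/-- Lemma 2.2: derivative of the energy along trajectories of the
regularized system. -/
theorem energy_derivative (a b η : ℝ) (ha : 0 < a) (hb : 0 < b)
    (hη : η ∈ Ioo 0 (Real.sqrt (a - b) - Real.sqrt (a / 2)))
    (φ : ℝ → ℝ → ℝ) (hφ : IsCutoff a b η φ) (x R : ℝ) (hR : 0 < R)
    (f g : ℝ → ℝ) (hsol : IsRegSolOn a b φ x f g (Ico 0 R)) :
    ∀ r ∈ Ioo 0 R,
      HasDerivAt (fun t => Ham a b (f t) (g t))
        (-(2 * φ (f r) (g r) / r) * (f r) ^ 2 * (1 - (g r) ^ 2)) r := by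
  intro r hr
  obtain ⟨-, -, -, -, h⟩ := hsol
  obtain ⟨hf, hg⟩ := h r ⟨hr.1.le, hr.2⟩ hr.1
  unfold Ham
  refine (((((hf.fun_pow 2).const_mul (1 / 2)).fun_mul ((hg.fun_pow 2).const_sub 1)).fun_add
    ((hg.fun_pow 4).const_mul (a / 4))).fun_sub ((hg.fun_pow 2).const_mul (b / 2))).congr_deriv ?_
  push_cast
  ring
end
end
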